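/- arXiv:2411.01452 — 3 statements merged into one kernel-verified Lean document; each statement's English description precedes it below -/
import Mathlib

section
/- Consider the Metropolis Markov chain P of the stochastic power expansion QMC on Ω = 𝒪^{2B} with stationary distribution π(x) = 2^{L(x)} ∏_k T(x_k)/Z. Assume 1 ≤ |𝒜| ≤ |ℬ|, |𝒪| ≤ 3N, and T_min ≥ 1, where T_max, T_min are the largest and smallest values of T. Then the mixing time t_mix := min{ t : max_{x∈Ω} ‖P^t(x,·) − π‖_TV ≤ 1/4 } satisfies t_mix ≤ 24 B³ N (T_max/T_min) 2^{8|𝒜|−4} ln(8 T_min), where ‖μ−ν‖_TV = (1/2) Σ_x |μ(x)−ν(x)| is the total variation distance. -/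
open SimpleGraph

variable {V : Type*}

/-- The relation generating the strand graph of a configuration `x` of `n` local
operators (each operator is a finite set of sites: an AFM edge in `E`, an FM edge
in `EF`, or a singleton vertex operator). -/
def strandRel (E EF : Finset (Finset V)) (n : ℕ) (x : Fin n → Finset V)
    (p q : V × Fin (n + 1)) : Prop :=
  ∃ t : Fin n,
    -- temporal edge at a site the operator does not act on
    (p.1 = q.1 ∧ p.1 ∉ x t ∧ p.2 = Fin.castSucc t ∧ q.2 = Fin.succ t) ∨
    -- bridge edges of an antiferromagnetic operator
    (x t ∈ E ∧ p.1 ∈ x t ∧ q.1 ∈ x t ∧ p.1 ≠ q.1 ∧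
      ((p.2 = Fin.castSucc t ∧ q.2 = Fin.castSucc t) ∨
       (p.2 = Fin.succ t ∧ q.2 = Fin.succ t))) ∨
    -- crossing edges of a ferromagnetic operator
    (x t ∈ EF ∧ p.1 ∈ x t ∧ q.1 ∈ x t ∧ p.1 ≠ q.1 ∧
      p.2 = Fin.castSucc t ∧ q.2 = Fin.succ t)

/-- The strand graph of a configuration. -/
def strandGraph (E EF : Finset (Finset V)) (n : ℕ) (x : Fin n → Finset V) :
    SimpleGraph (V × Fin (n + 1)) :=
  SimpleGraph.fromRel (strandRel E EF n x)

/-- `L(x)`: the number of loops (connected components of the strand graph). -/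
noncomputable def numLoops (E EF : Finset (Finset V)) (n : ℕ) (x : Fin n → Finset V) : ℕ :=
  Nat.card (strandGraph E EF n x).ConnectedComponent

variable [Fintype V] [DecidableEq V]

/-- The unnormalized weight `2^{L(x)} ∏_k T(x_k)` of a configuration. -/
noncomputable def confWt (E EF O : Finset (Finset V)) (B : ℕ)
    (T : {e : Finset V // e ∈ O} → ℝ) (x : Fin (2 * B) → {e : Finset V // e ∈ O}) : ℝ :=
  2 ^ numLoops E EF (2 * B) (fun t => (x t : Finset V)) * ∏ k, T (x k)

/-- The stationary distribution `π(x) = 2^{L(x)} ∏_k T(x_k) / Z`. -/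
noncomputable def piDist (E EF O : Finset (Finset V)) (B : ℕ)
    (T : {e : Finset V // e ∈ O} → ℝ) (x : Fin (2 * B) → {e : Finset V // e ∈ O}) : ℝ :=
  confWt E EF O B T x / ∑ y : Fin (2 * B) → {e : Finset V // e ∈ O}, confWt E EF O B T y

/-- Off-diagonal Metropolis transition probabilities: `(2B|𝒪|)⁻¹ min{1, π(y)/π(x)}`
if `y` differs from `x` in exactly one slot, `0` otherwise. -/
noncomputable def offDiag (E EF O : Finset (Finset V)) (B : ℕ)
    (T : {e : Finset V // e ∈ O} → ℝ)
    (x y : Fin (2 * B) → {e : Finset V // e ∈ O}) : ℝ :=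
  if x ≠ y ∧ ∃ k, ∀ j, j ≠ k → x j = y j then
    (1 / (2 * B * O.card)) * min 1 (piDist E EF O B T y / piDist E EF O B T x)
  else 0

/-- The Metropolis transition matrix of the SPE Markov chain. -/
noncomputable def transP (E EF O : Finset (Finset V)) (B : ℕ)
    (T : {e : Finset V // e ∈ O} → ℝ)
    (x y : Fin (2 * B) → {e : Finset V // e ∈ O}) : ℝ :=
  if x = y then 1 - ∑ y', offDiag E EF O B T x y' else offDiag E EF O B T x y

/-- The transition matrix as a `Matrix`, so that `t`-step transition probabilities are
given by matrix powers. -/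
noncomputable def transMat (E EF O : Finset (Finset V)) (B : ℕ)
    (T : {e : Finset V // e ∈ O} → ℝ) :
    Matrix (Fin (2 * B) → {e : Finset V // e ∈ O})
      (Fin (2 * B) → {e : Finset V // e ∈ O}) ℝ :=
  Matrix.of fun x y => transP E EF O B T x y

section GraphicRank

/-- The signed incidence vector of an edge. -/
def edgeVec {W : Type*} [DecidableEq W] (p q : W) : W → ℝ := Pi.single p 1 - Pi.single q 1

theorem card_connectedComponent_add_finrank_span {W : Type*} [Fintype W] [DecidableEq W]
    (r : W → W → Prop) :
    Nat.card (SimpleGraph.fromRel r).ConnectedComponent +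
      Module.finrank ℝ (Submodule.span ℝ {v | ∃ p q, r p q ∧ v = edgeVec p q}) =
      Fintype.card W := by
  classical
  set S := Submodule.span ℝ {v | ∃ p q, r p q ∧ v = edgeVec p q} with hS
  let b : LinearMap.BilinForm ℝ (W → ℝ) := dotProductBilin ℝ ℝ
  have hker : b.ker = ⊥ := by
    rw [LinearMap.ker_eq_bot']
    intro v hv
    exact dotProduct_self_eq_zero.1 (LinearMap.congr_fun hv v)
  have h1 := LinearMap.BilinForm.finrank_add_finrank_orthogonal' (B := b) S
  rw [hker, inf_bot_eq, finrank_bot, add_zero, Module.finrank_fintype_fun_eq_card] at h1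
  have h2 : b.orthogonal S = ((SimpleGraph.fromRel r).lapMatrix ℝ).toLin'.ker := by
    ext φ
    rw [LinearMap.mem_ker, Matrix.toLin'_apply,
      SimpleGraph.lapMatrix_mulVec_eq_zero_iff_forall_adj, LinearMap.BilinForm.mem_orthogonal_iff]
    have key : ∀ p q, b (edgeVec p q) φ = φ p - φ q := by
      intro p q
      change edgeVec p q ⬝ᵥ φ = _
      simp [edgeVec, sub_dotProduct]
    constructor
    · intro h
      have h' : ∀ p q, r p q → φ p = φ q := fun p q hpq =>
        sub_eq_zero.1 ((key p q).symm.trans (h _ (Submodule.subset_span ⟨p, q, hpq, rfl⟩)))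
      rintro p q ⟨-, hpq | hpq⟩
      · exact h' p q hpq
      · exact (h' q p hpq).symm
    · intro h v hv
      change b v φ = 0
      induction hv using Submodule.span_induction with
      | mem v hv =>
        obtain ⟨p, q, hpq, rfl⟩ := hv
        rw [key, sub_eq_zero]
        by_cases hne : p = q
        · rw [hne]
        · exact h p q ⟨hne, Or.inl hpq⟩
      | zero => simp
      | add u v _ _ hu hv => rw [map_add, LinearMap.add_apply, hu, hv, add_zero]
      | smul c v _ hv => rw [map_smul, LinearMap.smul_apply, hv, smul_zero]
  rw [h2, ← SimpleGraph.card_connectedComponent_eq_finrank_ker_toLin'_lapMatrix] at h1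
  rw [Nat.card_eq_fintype_card]
  omega

end GraphicRank

section Slots

/-- The edges of the strand graph created by an operator `o` in slot `t`. -/
def slotRel (E EF : Finset (Finset V)) (n : ℕ) (o : Finset V) (t : Fin n)
    (p q : V × Fin (n + 1)) : Prop :=
  (p.1 = q.1 ∧ p.1 ∉ o ∧ p.2 = Fin.castSucc t ∧ q.2 = Fin.succ t) ∨
  (o ∈ E ∧ p.1 ∈ o ∧ q.1 ∈ o ∧ p.1 ≠ q.1 ∧
    ((p.2 = Fin.castSucc t ∧ q.2 = Fin.castSucc t) ∨
      (p.2 = Fin.succ t ∧ q.2 = Fin.succ t))) ∨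
  (o ∈ EF ∧ p.1 ∈ o ∧ q.1 ∈ o ∧ p.1 ≠ q.1 ∧ p.2 = Fin.castSucc t ∧ q.2 = Fin.succ t)

/-- The span of the incidence vectors of the edges created by an operator `o` in slot `t`. -/
def slotSpace (E EF : Finset (Finset V)) (n : ℕ) (o : Finset V) (t : Fin n) :
    Submodule ℝ (V × Fin (n + 1) → ℝ) :=
  Submodule.span ℝ {v | ∃ p q, slotRel E EF n o t p q ∧ v = edgeVec p q}

theorem numLoops_add_finrank (E EF : Finset (Finset V)) (n : ℕ) (x : Fin n → Finset V) :
    numLoops E EF n x + Module.finrank ℝ (⨆ t, slotSpace E EF n (x t) t :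
      Submodule ℝ (V × Fin (n + 1) → ℝ)) = Fintype.card V * (n + 1) := by
  have h := card_connectedComponent_add_finrank_span (strandRel E EF n x)
  have hsp : Submodule.span ℝ {v | ∃ p q, strandRel E EF n x p q ∧ v = edgeVec p q} =
      ⨆ t, slotSpace E EF n (x t) t := by
    simp only [slotSpace]
    rw [← Submodule.span_iUnion]
    congr 1
    ext v
    simp only [Set.mem_ofPred_eq, Set.mem_iUnion]
    constructor
    · rintro ⟨p, q, ⟨t, ht⟩, rfl⟩
      exact ⟨t, p, q, ht, rfl⟩
    · rintro ⟨t, p, q, ht, rfl⟩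
      exact ⟨p, q, ⟨t, ht⟩, rfl⟩
  rw [hsp, Fintype.card_prod, Fintype.card_fin] at h
  exact h

theorem edgeVec_apply_of_ne {W : Type*} [DecidableEq W] {p q w : W} (hp : w ≠ p) (hq : w ≠ q) :
    edgeVec p q w = 0 := by
  simp [edgeVec, hp, hq]

/-- Elements of a slot space vanish away from the two levels adjacent to the slot. -/
theorem slotSpace_apply_eq_zero {E EF : Finset (Finset V)} {n : ℕ} {o : Finset V} {t : Fin n}
    {h : V × Fin (n + 1) → ℝ} (hh : h ∈ slotSpace E EF n o t) (w : V × Fin (n + 1))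
    (h1 : w.2 ≠ t.castSucc) (h2 : w.2 ≠ t.succ) : h w = 0 := by
  induction hh using Submodule.span_induction with
  | mem v hv =>
    obtain ⟨p, q, hpq, rfl⟩ := hv
    apply edgeVec_apply_of_ne
    · rintro rfl
      unfold slotRel at hpq
      tauto
    · rintro rfl
      unfold slotRel at hpq
      tauto
  | zero => rfl
  | add u v _ _ hu hv => rw [Pi.add_apply, hu, hv, add_zero]
  | smul c v _ hv => rw [Pi.smul_apply, hv, smul_zero]

/-- A linear identity `h a + h b = 0` holds on a slot space once it holds on its generators. -/
theorem slotSpace_apply_add_eq_zero {E EF : Finset (Finset V)} {n : ℕ} {o : Finset V} {t : Fin n}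
    {a b : V × Fin (n + 1)}
    (hab : ∀ p q, slotRel E EF n o t p q → edgeVec p q a + edgeVec p q b = 0)
    {h : V × Fin (n + 1) → ℝ} (hh : h ∈ slotSpace E EF n o t) : h a + h b = 0 := by
  induction hh using Submodule.span_induction with
  | mem v hv =>
    obtain ⟨p, q, hpq, rfl⟩ := hv
    exact hab p q hpq
  | zero => simp
  | add u v _ _ hu hv => simp only [Pi.add_apply]; linarith
  | smul c v _ hv => simp only [Pi.smul_apply, smul_eq_mul]; linear_combination c * hv

/-- The operators allowed on a bipartite lattice: AFM edges join the two parts, FM edges stay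
inside one part, everything else acts on a single site. -/
def IsAllowed (A : Finset V) (E EF : Finset (Finset V)) (o : Finset V) : Prop :=
  (∃ i j : V, i ∈ A ∧ j ∉ A ∧ o = {i, j} ∧ o ∈ E ∧ o ∉ EF) ∨
  (∃ i j : V, i ≠ j ∧ (i ∈ A ↔ j ∈ A) ∧ o = {i, j} ∧ o ∉ E ∧ o ∈ EF) ∨
  (∃ i : V, o = {i} ∧ o ∉ E ∧ o ∉ EF)

/-- The staggered sum of squares agrees on the two levels adjacent to a slot. -/
theorem slotSpace_staggered_sq {A : Finset V} {E EF : Finset (Finset V)} {n : ℕ} {o : Finset V}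
    (ho : IsAllowed A E EF o) {t : Fin n}
    {h : V × Fin (n + 1) → ℝ} (hh : h ∈ slotSpace E EF n o t) :
    ∑ i, (if i ∈ A then (1 : ℝ) else -1) * h (i, t.succ) ^ 2 =
      ∑ i, (if i ∈ A then (1 : ℝ) else -1) * h (i, t.castSucc) ^ 2 := by
  have hne : t.castSucc ≠ t.succ := (Fin.castSucc_lt_succ).ne
  rw [← sub_eq_zero, ← Finset.sum_sub_distrib, ← Finset.sum_add_sum_compl o]
  have hcompl : ∑ i ∈ oᶜ, ((if i ∈ A then (1 : ℝ) else -1) * h (i, t.succ) ^ 2 -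
      (if i ∈ A then (1 : ℝ) else -1) * h (i, t.castSucc) ^ 2) = 0 := by
    refine Finset.sum_eq_zero fun i hi => ?_
    rw [Finset.mem_compl] at hi
    have : h (i, t.succ) + h (i, t.castSucc) = 0 := by
      refine slotSpace_apply_add_eq_zero ?_ hh
      rintro ⟨p1, p2⟩ ⟨q1, q2⟩ hpq
      unfold slotRel at hpq
      simp only [edgeVec, Pi.sub_apply, Pi.single_apply, Prod.mk.injEq] at hpq ⊢
      grind
    rw [eq_neg_of_add_eq_zero_left this]
    ring
  rw [hcompl, add_zero]
  rcases ho with ⟨i, j, hi, hj, rfl, hE, hEF⟩ | ⟨i, j, hij, hA, rfl, hE, hEF⟩ | ⟨i, rfl, hE, hEF⟩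
  · have hij : i ≠ j := fun h => hj (h ▸ hi)
    have h1 : h (i, t.succ) + h (j, t.succ) = 0 := by
      refine slotSpace_apply_add_eq_zero ?_ hh
      rintro ⟨p1, p2⟩ ⟨q1, q2⟩ hpq
      unfold slotRel at hpq
      simp only [edgeVec, Pi.sub_apply, Pi.single_apply, Prod.mk.injEq, Finset.mem_insert,
        Finset.mem_singleton] at hpq ⊢
      grind
    have h2 : h (i, t.castSucc) + h (j, t.castSucc) = 0 := by
      refine slotSpace_apply_add_eq_zero ?_ hh
      rintro ⟨p1, p2⟩ ⟨q1, q2⟩ hpq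
      unfold slotRel at hpq
      simp only [edgeVec, Pi.sub_apply, Pi.single_apply, Prod.mk.injEq, Finset.mem_insert,
        Finset.mem_singleton] at hpq ⊢
      grind
    rw [Finset.sum_pair hij, eq_neg_of_add_eq_zero_left h1, eq_neg_of_add_eq_zero_left h2]
    simp only [hi, hj, if_true, if_false]
    ring
  · have h1 : h (i, t.succ) + h (j, t.castSucc) = 0 := by
      refine slotSpace_apply_add_eq_zero ?_ hh
      rintro ⟨p1, p2⟩ ⟨q1, q2⟩ hpq
      unfold slotRel at hpq
      simp only [edgeVec, Pi.sub_apply, Pi.single_apply, Prod.mk.injEq, Finset.mem_insert,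
        Finset.mem_singleton] at hpq ⊢
      grind
    have h2 : h (j, t.succ) + h (i, t.castSucc) = 0 := by
      refine slotSpace_apply_add_eq_zero ?_ hh
      rintro ⟨p1, p2⟩ ⟨q1, q2⟩ hpq
      unfold slotRel at hpq
      simp only [edgeVec, Pi.sub_apply, Pi.single_apply, Prod.mk.injEq, Finset.mem_insert,
        Finset.mem_singleton] at hpq ⊢
      grind
    rw [Finset.sum_pair hij, eq_neg_of_add_eq_zero_left h1, eq_neg_of_add_eq_zero_left h2]
    simp only [hA]
    ring
  · have h1 : ∀ s, h (i, s) + h (i, s) = 0 := fun s => by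
      refine slotSpace_apply_add_eq_zero ?_ hh
      rintro ⟨p1, p2⟩ ⟨q1, q2⟩ hpq
      unfold slotRel at hpq
      simp only [edgeVec, Pi.sub_apply, Pi.single_apply, Prod.mk.injEq,
        Finset.mem_singleton] at hpq ⊢
      grind
    have h2 : ∀ s, h (i, s) = 0 := fun s => by linarith [h1 s]
    rw [Finset.sum_singleton, h2, h2]
    ring

/-- The span of the edges in the slots satisfying `P`. -/
def partSpace (E EF : Finset (Finset V)) (n : ℕ) (x : Fin n → Finset V) (P : Fin n → Prop) :
    Submodule ℝ (V × Fin (n + 1) → ℝ) :=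
  ⨆ t, ⨆ _ : P t, slotSpace E EF n (x t) t

theorem partSpace_le_iff {E EF : Finset (Finset V)} {n : ℕ} {x : Fin n → Finset V}
    {P : Fin n → Prop} {S : Submodule ℝ (V × Fin (n + 1) → ℝ)} :
    partSpace E EF n x P ≤ S ↔ ∀ t, P t → slotSpace E EF n (x t) t ≤ S := by
  simp [partSpace]

theorem slotSpace_le_partSpace {E EF : Finset (Finset V)} {n : ℕ} {x : Fin n → Finset V}
    {P : Fin n → Prop} {t : Fin n} (ht : P t) :
    slotSpace E EF n (x t) t ≤ partSpace E EF n x P :=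
  le_iSup₂_of_le t ht le_rfl

/-- The functions supported on a set of points, as a submodule. -/
def supportedOn {W : Type*} (s : Set W) : Submodule ℝ (W → ℝ) where
  carrier := {f | ∀ w, w ∉ s → f w = 0}
  add_mem' := fun {f g} hf hg w hw => by rw [Pi.add_apply, hf w hw, hg w hw, add_zero]
  zero_mem' := fun _ _ => rfl
  smul_mem' := fun c f hf w hw => by rw [Pi.smul_apply, hf w hw, smul_zero]

theorem partSpace_lt_le_supportedOn (E EF : Finset (Finset V)) (n : ℕ) (x : Fin n → Finset V)
    (k : ℕ) : partSpace E EF n x (fun t => t.val < k) ≤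
      supportedOn {w : V × Fin (n + 1) | w.2.val ≤ k} := by
  rw [partSpace_le_iff]
  intro t ht h hh w hw
  simp only [Set.mem_ofPred_eq, not_le] at hw
  refine slotSpace_apply_eq_zero hh w ?_ ?_ <;> intro h' <;> rw [h'] at hw <;> simp at hw <;> omega

theorem partSpace_ge_le_supportedOn (E EF : Finset (Finset V)) (n : ℕ) (x : Fin n → Finset V)
    (k : ℕ) : partSpace E EF n x (fun t => ¬ t.val < k) ≤
      supportedOn {w : V × Fin (n + 1) | k ≤ w.2.val} := by
  rw [partSpace_le_iff]
  intro t ht h hh w hw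
  simp only [Set.mem_ofPred_eq, not_le] at hw
  refine slotSpace_apply_eq_zero hh w ?_ ?_ <;> intro h' <;> rw [h'] at hw <;> simp at hw <;> omega

theorem partSpace_staggered_sq {A : Finset V} {E EF : Finset (Finset V)} {n : ℕ}
    {x : Fin n → Finset V} (hx : ∀ t, IsAllowed A E EF (x t)) (k : ℕ) (hk : k ≤ n)
    (f : V × Fin (n + 1) → ℝ) (hf : f ∈ partSpace E EF n x (fun t => t.val < k))
    (hsupp : ∀ w, w.2.val ≠ k → f w = 0) :
    ∑ i, (if i ∈ A then (1 : ℝ) else -1) * f (i, ⟨k, Nat.lt_succ_of_le hk⟩) ^ 2 = 0 := by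
  induction k generalizing f with
  | zero =>
    have : f = 0 := by simpa [partSpace] using hf
    simp [this]
  | succ k ih =>
    have hkn : k < n := hk
    let t : Fin n := ⟨k, hkn⟩
    have hle : partSpace E EF n x (fun t => t.val < k + 1) ≤
        partSpace E EF n x (fun t => t.val < k) ⊔ slotSpace E EF n (x t) t := by
      rw [partSpace_le_iff]
      intro s hs
      rcases Nat.lt_succ_iff_lt_or_eq.1 hs with hs | hs
      · exact le_sup_of_le_left (slotSpace_le_partSpace (P := fun t => t.val < k) hs)
      · have : s = t := Fin.ext hs
        rw [this]
        exact le_sup_right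
    obtain ⟨g, hg, h, hh, rfl⟩ := Submodule.mem_sup.1 (hle hf)
    have hgs := partSpace_lt_le_supportedOn E EF n x k hg
    have hgk : ∀ w : V × Fin (n + 1), w.2.val ≠ k → g w = 0 := by
      intro w hw
      by_cases hlt : k < w.2.val
      · exact hgs w (by simpa using hlt)
      · have h1 : h w = 0 := by
          refine slotSpace_apply_eq_zero hh w ?_ ?_ <;> intro h' <;> rw [h'] at hw hlt <;>
            simp [t] at hw hlt
        have h2 := hsupp w (by omega)
        rw [Pi.add_apply, h1, add_zero] at h2
        exact h2
    have h0 := ih hkn.le g hg hgk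
    have hst := slotSpace_staggered_sq (hx t) hh
    have e1 : ∀ i, (g + h) (i, ⟨k + 1, Nat.lt_succ_of_le hk⟩) = h (i, t.succ) := by
      intro i
      rw [Pi.add_apply, hgk _ (by simp), zero_add]
      rfl
    have e2 : ∀ i, g (i, ⟨k, Nat.lt_succ_of_le hkn.le⟩) = - h (i, t.castSucc) := by
      intro i
      have := hsupp (i, t.castSucc) (by simp [t])
      rw [Pi.add_apply] at this
      exact eq_neg_of_add_eq_zero_left this
    simp only [e1]
    rw [hst, ← h0]
    simp only [e2, neg_sq]

theorem finrank_partSpace_inf_le {A : Finset V} {E EF : Finset (Finset V)} {n : ℕ}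
    {x y : Fin n → Finset V} (hx : ∀ t, IsAllowed A E EF (x t)) (k : ℕ) (hk : k ≤ n) :
    Module.finrank ℝ (partSpace E EF n x (fun t => t.val < k) ⊓
      partSpace E EF n y (fun t => ¬ t.val < k) :
        Submodule ℝ (V × Fin (n + 1) → ℝ)) ≤ A.card := by
  set S := (partSpace E EF n x (fun t => t.val < k) ⊓
      partSpace E EF n y (fun t => ¬ t.val < k) : Submodule ℝ (V × Fin (n + 1) → ℝ)) with hS
  let R : (V × Fin (n + 1) → ℝ) →ₗ[ℝ] (A → ℝ) :=
    LinearMap.funLeft ℝ ℝ fun i : A => ((i : V), (⟨k, Nat.lt_succ_of_le hk⟩ : Fin (n + 1)))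
  have hinj : Function.Injective (R.comp S.subtype) := by
    rw [injective_iff_map_eq_zero]
    rintro ⟨f, hf⟩ hRf
    have hf1 := partSpace_lt_le_supportedOn E EF n x k hf.1
    have hf2 := partSpace_ge_le_supportedOn E EF n y k hf.2
    have hsupp : ∀ w, w.2.val ≠ k → f w = 0 := by
      intro w hw
      rcases lt_or_gt_of_ne hw with h | h
      · exact hf2 w (by simpa using h)
      · exact hf1 w (by simpa using h)
    have hA : ∀ i ∈ A, f (i, ⟨k, Nat.lt_succ_of_le hk⟩) = 0 := fun i hi =>
      congrFun hRf ⟨i, hi⟩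
    have hsq := partSpace_staggered_sq hx k hk f hf.1 hsupp
    have hsq' : ∑ i, f (i, ⟨k, Nat.lt_succ_of_le hk⟩) ^ 2 = 0 := by
      rw [← neg_eq_zero, ← Finset.sum_neg_distrib, ← hsq]
      refine Finset.sum_congr rfl fun i _ => ?_
      by_cases hi : i ∈ A
      · simp [hA i hi]
      · simp [hi]
    rw [Finset.sum_eq_zero_iff_of_nonneg fun i _ => sq_nonneg _] at hsq'
    apply Subtype.ext
    funext ⟨i, s⟩
    by_cases hs : s.val = k
    · have : s = ⟨k, Nat.lt_succ_of_le hk⟩ := Fin.ext hs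
      rw [this]
      exact pow_eq_zero_iff (two_ne_zero) |>.1 (hsq' i (Finset.mem_univ i))
    · exact hsupp _ hs
  have := LinearMap.finrank_le_finrank_of_injective hinj
  simpa using this

theorem numLoops_add_finrank_sup (E EF : Finset (Finset V)) (n : ℕ) (x : Fin n → Finset V)
    (P : Fin n → Prop) :
    numLoops E EF n x + Module.finrank ℝ (partSpace E EF n x P ⊔
      partSpace E EF n x (fun t => ¬ P t) :
        Submodule ℝ (V × Fin (n + 1) → ℝ)) = Fintype.card V * (n + 1) := by
  have h : partSpace E EF n x P ⊔ partSpace E EF n x (fun t => ¬ P t) =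
      ⨆ t, slotSpace E EF n (x t) t := by
    apply le_antisymm
    · rw [sup_le_iff, partSpace_le_iff, partSpace_le_iff]
      exact ⟨fun t _ => le_iSup (fun t => slotSpace E EF n (x t) t) t,
        fun t _ => le_iSup (fun t => slotSpace E EF n (x t) t) t⟩
    · refine iSup_le fun t => ?_
      by_cases ht : P t
      · exact le_sup_of_le_left (slotSpace_le_partSpace ht)
      · exact le_sup_of_le_right (slotSpace_le_partSpace (P := fun t => ¬ P t) ht)
  rw [h, numLoops_add_finrank]

theorem partSpace_congr {E EF : Finset (Finset V)} {n : ℕ} {x y : Fin n → Finset V}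
    {P : Fin n → Prop} (h : ∀ t, P t → x t = y t) :
    partSpace E EF n x P = partSpace E EF n y P := by
  unfold partSpace
  refine iSup_congr fun t => iSup_congr fun ht => ?_
  rw [h t ht]

/-- Exchanging the first `k` slots of two configurations changes the total number of loops by at
most twice the size of one part of the lattice. -/
theorem numLoops_exchange {A : Finset V} {E EF : Finset (Finset V)} {n : ℕ}
    {x y z z' : Fin n → Finset V} (hx : ∀ t, IsAllowed A E EF (x t))
    (hy : ∀ t, IsAllowed A E EF (y t)) (k : ℕ) (hk : k ≤ n)
    (hz : ∀ t, z t = if t.val < k then y t else x t)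
    (hz' : ∀ t, z' t = if t.val < k then x t else y t) :
    numLoops E EF n x + numLoops E EF n y ≤
      numLoops E EF n z + numLoops E EF n z' + 2 * A.card := by
  have ex := numLoops_add_finrank_sup E EF n x (fun t => t.val < k)
  have ey := numLoops_add_finrank_sup E EF n y (fun t => t.val < k)
  have ez := numLoops_add_finrank_sup E EF n z (fun t => t.val < k)
  have ez' := numLoops_add_finrank_sup E EF n z' (fun t => t.val < k)
  have z1 : partSpace E EF n z (fun t => t.val < k) = partSpace E EF n y (fun t => t.val < k) :=
    partSpace_congr fun t ht => by rw [hz, if_pos ht]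
  have z2 : partSpace E EF n z (fun t => ¬ t.val < k) =
      partSpace E EF n x (fun t => ¬ t.val < k) :=
    partSpace_congr fun t ht => by rw [hz, if_neg ht]
  have z3 : partSpace E EF n z' (fun t => t.val < k) = partSpace E EF n x (fun t => t.val < k) :=
    partSpace_congr fun t ht => by rw [hz', if_pos ht]
  have z4 : partSpace E EF n z' (fun t => ¬ t.val < k) =
      partSpace E EF n y (fun t => ¬ t.val < k) :=
    partSpace_congr fun t ht => by rw [hz', if_neg ht]
  rw [z1, z2] at ez
  rw [z3, z4] at ez'
  have ix := finrank_partSpace_inf_le (E := E) (EF := EF) (y := x) hx k hk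
  have iy := finrank_partSpace_inf_le (E := E) (EF := EF) (y := y) hy k hk
  have sx := Submodule.finrank_sup_add_finrank_inf_eq
    (partSpace E EF n x (fun t => t.val < k)) (partSpace E EF n x (fun t => ¬ t.val < k))
  have sy := Submodule.finrank_sup_add_finrank_inf_eq
    (partSpace E EF n y (fun t => t.val < k)) (partSpace E EF n y (fun t => ¬ t.val < k))
  have sz := Submodule.finrank_add_le_finrank_add_finrank
    (partSpace E EF n y (fun t => t.val < k)) (partSpace E EF n x (fun t => ¬ t.val < k))
  have sz' := Submodule.finrank_add_le_finrank_add_finrank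
    (partSpace E EF n x (fun t => t.val < k)) (partSpace E EF n y (fun t => ¬ t.val < k))
  omega

/-- The incidence vector of the temporal edge at site `i` in slot `t`. -/
def temporalVec (n : ℕ) (t : Fin n) (i : V) : V × Fin (n + 1) → ℝ :=
  edgeVec (i, t.castSucc) (i, t.succ)

theorem IsAllowed.card_le {A : Finset V} {E EF : Finset (Finset V)} {o : Finset V}
    (ho : IsAllowed A E EF o) : o.card ≤ 2 := by
  rcases ho with ⟨i, j, -, -, rfl, -⟩ | ⟨i, j, -, -, rfl, -⟩ | ⟨i, rfl, -⟩
  · exact Finset.card_le_two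
  · exact Finset.card_le_two
  · simp

theorem temporalVec_mem_slotSpace {E EF : Finset (Finset V)} {n : ℕ} {o : Finset V} {t : Fin n}
    {i : V} (hi : i ∉ o) : temporalVec n t i ∈ slotSpace E EF n o t :=
  Submodule.subset_span ⟨(i, t.castSucc), (i, t.succ), Or.inl ⟨rfl, hi, rfl, rfl⟩, rfl⟩

theorem edgeVec_swap {W : Type*} [DecidableEq W] (p q : W) : edgeVec q p = - edgeVec p q := by
  simp [edgeVec]

/-- A slot space is spanned by one vector per site, which is the incidence vector of the temporal
edge at sites on which the operator does not act. -/
theorem slotSpace_le_span_range {A : Finset V} {E EF : Finset (Finset V)} {n : ℕ} {o : Finset V}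
    (ho : IsAllowed A E EF o) (t : Fin n) :
    ∃ c : V → V × Fin (n + 1) → ℝ, (∀ i, i ∉ o → c i = temporalVec n t i) ∧
      slotSpace E EF n o t ≤ Submodule.span ℝ (Set.range c) := by
  have temporal : ∀ c : V → V × Fin (n + 1) → ℝ, (∀ i, i ∉ o → c i = temporalVec n t i) →
      ∀ p q : V × Fin (n + 1), p.1 = q.1 ∧ p.1 ∉ o ∧ p.2 = t.castSucc ∧ q.2 = t.succ →
        edgeVec p q ∈ Submodule.span ℝ (Set.range c) := by
    rintro c hc ⟨p1, p2⟩ ⟨q1, q2⟩ ⟨h1, h2, h3, h4⟩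
    simp only at h1 h2 h3 h4
    subst h1 h3 h4
    exact Submodule.subset_span ⟨p1, hc p1 h2⟩
  rcases ho with ⟨i, j, hi, hj, rfl, hE, hEF⟩ | ⟨i, j, hij, hA, rfl, hE, hEF⟩ | ⟨i, rfl, hE, hEF⟩
  · have hij : i ≠ j := fun h => hj (h ▸ hi)
    let c : V → V × Fin (n + 1) → ℝ := fun l =>
      if l = i then edgeVec (i, t.castSucc) (j, t.castSucc)
      else if l = j then edgeVec (i, t.succ) (j, t.succ) else temporalVec n t l
    have hc : ∀ l, l ∉ ({i, j} : Finset V) → c l = temporalVec n t l := by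
      intro l hl
      simp only [Finset.mem_insert, Finset.mem_singleton, not_or] at hl
      simp [c, hl.1, hl.2]
    refine ⟨c, hc, Submodule.span_le.2 ?_⟩
    have m1 : edgeVec (i, t.castSucc) (j, t.castSucc) ∈ Submodule.span ℝ (Set.range c) :=
      Submodule.subset_span ⟨i, by simp [c]⟩
    have m2 : edgeVec (i, t.succ) (j, t.succ) ∈ Submodule.span ℝ (Set.range c) :=
      Submodule.subset_span ⟨j, by simp [c, hij.symm]⟩
    rintro v ⟨p, q, hpq | hpq | hpq, rfl⟩
    · exact temporal c hc p q hpq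
    · obtain ⟨p1, p2⟩ := p
      obtain ⟨q1, q2⟩ := q
      obtain ⟨-, h1, h2, h3, h4⟩ := hpq
      simp only [Finset.mem_insert, Finset.mem_singleton] at h1 h2 h3 h4
      rcases h1 with rfl | rfl <;> rcases h2 with rfl | rfl <;>
        rcases h4 with ⟨rfl, rfl⟩ | ⟨rfl, rfl⟩ <;>
        first
          | exact absurd rfl h3
          | exact m1
          | exact m2
          | exact (edgeVec_swap (W := V × Fin (n + 1)) _ _) ▸ Submodule.neg_mem _ m1
          | exact (edgeVec_swap (W := V × Fin (n + 1)) _ _) ▸ Submodule.neg_mem _ m2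
    · exact absurd hpq.1 hEF
  · let c : V → V × Fin (n + 1) → ℝ := fun l =>
      if l = i then edgeVec (i, t.castSucc) (j, t.succ)
      else if l = j then edgeVec (j, t.castSucc) (i, t.succ) else temporalVec n t l
    have hc : ∀ l, l ∉ ({i, j} : Finset V) → c l = temporalVec n t l := by
      intro l hl
      simp only [Finset.mem_insert, Finset.mem_singleton, not_or] at hl
      simp [c, hl.1, hl.2]
    refine ⟨c, hc, Submodule.span_le.2 ?_⟩
    have m1 : edgeVec (i, t.castSucc) (j, t.succ) ∈ Submodule.span ℝ (Set.range c) :=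
      Submodule.subset_span ⟨i, by simp [c]⟩
    have m2 : edgeVec (j, t.castSucc) (i, t.succ) ∈ Submodule.span ℝ (Set.range c) :=
      Submodule.subset_span ⟨j, by simp [c, hij.symm]⟩
    rintro v ⟨p, q, hpq | hpq | hpq, rfl⟩
    · exact temporal c hc p q hpq
    · exact absurd hpq.1 hE
    · obtain ⟨p1, p2⟩ := p
      obtain ⟨q1, q2⟩ := q
      obtain ⟨-, h1, h2, h3, h4, h5⟩ := hpq
      simp only [Finset.mem_insert, Finset.mem_singleton] at h1 h2 h3 h4 h5
      subst h4 h5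
      rcases h1 with rfl | rfl <;> rcases h2 with rfl | rfl
      · exact absurd rfl h3
      · exact m1
      · exact m2
      · exact absurd rfl h3
  · refine ⟨temporalVec n t, fun _ _ => rfl, Submodule.span_le.2 ?_⟩
    rintro v ⟨p, q, hpq | hpq | hpq, rfl⟩
    · exact temporal _ (fun _ _ => rfl) p q hpq
    · exact absurd hpq.1 hE
    · exact absurd hpq.1 hEF

theorem le_numLoops {A : Finset V} {E EF : Finset (Finset V)} {n : ℕ}
    {x : Fin n → Finset V} (hx : ∀ t, IsAllowed A E EF (x t)) :
    Fintype.card V ≤ numLoops E EF n x := by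
  choose c _ hc using fun t => slotSpace_le_span_range (hx t) t
  have hle : (⨆ t, slotSpace E EF n (x t) t) ≤
      Submodule.span ℝ (Set.range fun p : V × Fin n => c p.2 p.1) := by
    refine iSup_le fun t => (hc t).trans (Submodule.span_mono ?_)
    rintro _ ⟨i, rfl⟩
    exact ⟨(i, t), rfl⟩
  have h1 := (Submodule.finrank_mono hle).trans (finrank_range_le_card _)
  have h2 := numLoops_add_finrank E EF n x
  rw [Fintype.card_prod, Fintype.card_fin] at h1
  rw [mul_add, mul_one] at h2
  omega

theorem numLoops_empty_le (E EF : Finset (Finset V)) (n : ℕ) :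
    numLoops E EF n (fun _ => ∅) ≤ Fintype.card V := by
  rw [← Nat.card_eq_fintype_card]
  refine Nat.card_le_card_of_surjective
    (fun i : V => (strandGraph E EF n fun _ => ∅).connectedComponentMk (i, 0)) ?_
  intro c
  induction c using SimpleGraph.ConnectedComponent.ind with
  | h p =>
    obtain ⟨i, s⟩ := p
    refine ⟨i, SimpleGraph.ConnectedComponent.sound ?_⟩
    induction s using Fin.induction with
    | zero => exact SimpleGraph.Reachable.refl _
    | succ t ih =>
      refine ih.trans (SimpleGraph.Adj.reachable ?_)
      refine ⟨fun h => (Fin.castSucc_lt_succ (i := t)).ne (Prod.ext_iff.1 h).2, Or.inl ⟨t, ?_⟩⟩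
      exact Or.inl ⟨rfl, Finset.notMem_empty _, rfl, rfl⟩

theorem slotSpace_empty_le (E EF : Finset (Finset V)) (n : ℕ) (t : Fin n) :
    slotSpace E EF n ∅ t ≤ Submodule.span ℝ (Set.range (temporalVec n t)) := by
  refine Submodule.span_le.2 ?_
  rintro v ⟨⟨p1, p2⟩, ⟨q1, q2⟩, hpq, rfl⟩
  simp only [slotRel, Finset.notMem_empty, false_and, and_false, or_false] at hpq
  obtain ⟨rfl, -, rfl, rfl⟩ := hpq
  exact Submodule.subset_span ⟨p1, rfl⟩

theorem finrank_le_finrank_add_card {W : Type*} [Fintype W] [DecidableEq W]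
    {S T : Submodule ℝ (W → ℝ)} (F : Finset (W → ℝ))
    (h : S ≤ T ⊔ Submodule.span ℝ (F : Set (W → ℝ))) :
    Module.finrank ℝ S ≤ Module.finrank ℝ T + F.card := by
  refine (Submodule.finrank_mono h).trans
    ((Submodule.finrank_add_le_finrank_add_finrank _ _).trans ?_)
  exact Nat.add_le_add_left (finrank_span_finset_le_card F) _

theorem numLoops_le {A : Finset V} {E EF : Finset (Finset V)} {n : ℕ}
    {x : Fin n → Finset V} (hx : ∀ t, IsAllowed A E EF (x t)) :
    numLoops E EF n x ≤ Fintype.card V + 2 * n := by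
  classical
  have h0 := numLoops_add_finrank E EF n (fun _ => ∅)
  have h1 := numLoops_add_finrank E EF n x
  have h2 := numLoops_empty_le E EF n
  let F : Finset (V × Fin (n + 1) → ℝ) :=
    Finset.univ.biUnion fun t => (x t).image (temporalVec n t)
  have hF : F.card ≤ 2 * n := by
    refine Finset.card_biUnion_le.trans ((Finset.sum_le_card_nsmul _ _ 2 fun t _ =>
      Finset.card_image_le.trans (hx t).card_le).trans ?_)
    simp [mul_comm]
  have hle : (⨆ t, slotSpace E EF n ∅ t) ≤ (⨆ t, slotSpace E EF n (x t) t) ⊔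
      Submodule.span ℝ (F : Set (V × Fin (n + 1) → ℝ)) := by
    refine iSup_le fun t => (slotSpace_empty_le E EF n t).trans (Submodule.span_le.2 ?_)
    rintro _ ⟨i, rfl⟩
    by_cases hi : i ∈ x t
    · refine Submodule.mem_sup_right (Submodule.subset_span ?_)
      simp only [F, Finset.coe_biUnion, Set.mem_iUnion]
      exact ⟨t, Finset.mem_univ t, Finset.mem_coe.2 (Finset.mem_image_of_mem _ hi)⟩
    · exact Submodule.mem_sup_left ((le_iSup (fun t => slotSpace E EF n (x t) t) t)
        (temporalVec_mem_slotSpace hi))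
  have h3 := finrank_le_finrank_add_card F hle
  omega

/-- Changing the operator in one slot changes the number of loops by at most four. -/
theorem numLoops_le_of_eq_off {A : Finset V} {E EF : Finset (Finset V)} {n : ℕ}
    {x y : Fin n → Finset V} (hx : ∀ t, IsAllowed A E EF (x t))
    (hy : ∀ t, IsAllowed A E EF (y t)) (k : Fin n) (hxy : ∀ t, t ≠ k → x t = y t) :
    numLoops E EF n x ≤ numLoops E EF n y + 4 := by
  classical
  have h0 := numLoops_add_finrank E EF n y
  have h1 := numLoops_add_finrank E EF n x
  obtain ⟨c, hc, hle⟩ := slotSpace_le_span_range (hy k) k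
  let F : Finset (V × Fin (n + 1) → ℝ) := (x k).image (temporalVec n k) ∪ (y k).image c
  have hF : F.card ≤ 4 := by
    refine (Finset.card_union_le _ _).trans ?_
    have := (Finset.card_image_le (s := x k) (f := temporalVec n k)).trans (hx k).card_le
    have := (Finset.card_image_le (s := y k) (f := c)).trans (hy k).card_le
    omega
  have hle' : (⨆ t, slotSpace E EF n (y t) t) ≤ (⨆ t, slotSpace E EF n (x t) t) ⊔
      Submodule.span ℝ (F : Set (V × Fin (n + 1) → ℝ)) := by
    refine iSup_le fun t => ?_
    by_cases ht : t = k
    · subst ht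
      refine hle.trans (Submodule.span_le.2 ?_)
      rintro _ ⟨i, rfl⟩
      by_cases hi : i ∈ y t
      · exact Submodule.mem_sup_right (Submodule.subset_span
          (Finset.mem_coe.2 (Finset.mem_union_right _ (Finset.mem_image_of_mem _ hi))))
      rw [hc i hi]
      by_cases hi' : i ∈ x t
      · exact Submodule.mem_sup_right (Submodule.subset_span
          (Finset.mem_coe.2 (Finset.mem_union_left _ (Finset.mem_image_of_mem _ hi'))))
      · exact Submodule.mem_sup_left ((le_iSup (fun t => slotSpace E EF n (x t) t) t)
          (temporalVec_mem_slotSpace hi'))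
    · rw [← hxy t ht]
      exact le_sup_of_le_left (le_iSup (fun t => slotSpace E EF n (x t) t) t)
  have h3 := finrank_le_finrank_add_card F hle'
  omega

end Slots

section ReversibleChain

variable {Ω : Type*} [Fintype Ω]

open Matrix

/-- A reversible positive semidefinite kernel whose quadratic form is at most `lam` times the
squared norm on mean-zero functions contracts the norm of mean-zero functions by `lam`. -/
theorem sum_sq_mulVec_le {p : Ω → ℝ} (hp : ∀ x, 0 < p x) {P : Matrix Ω Ω ℝ}
    (hrev : ∀ x y, p x * P x y = p y * P y x) (hrow : ∀ x, ∑ y, P x y = 1)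
    {lam : ℝ} (hlam : 0 < lam)
    (h0 : ∀ f : Ω → ℝ, 0 ≤ ∑ x, p x * f x * (P *ᵥ f) x)
    (h1 : ∀ f : Ω → ℝ, ∑ x, p x * f x = 0 →
      ∑ x, p x * f x * (P *ᵥ f) x ≤ lam * ∑ x, p x * f x ^ 2)
    {f : Ω → ℝ} (hf : ∑ x, p x * f x = 0) :
    ∑ x, p x * (P *ᵥ f) x = 0 ∧
      ∑ x, p x * (P *ᵥ f) x ^ 2 ≤ lam ^ 2 * ∑ x, p x * f x ^ 2 := by
  have hsymm : ∀ u v : Ω → ℝ,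
      ∑ x, p x * u x * (P *ᵥ v) x = ∑ x, p x * v x * (P *ᵥ u) x := by
    intro u v
    simp only [mulVec, dotProduct, Finset.mul_sum]
    rw [Finset.sum_comm]
    refine Finset.sum_congr rfl fun x _ => Finset.sum_congr rfl fun y _ => ?_
    linear_combination (u y * v x) * hrev y x
  have hone : P *ᵥ (fun _ => (1 : ℝ)) = fun _ => 1 := by
    funext x
    simp [mulVec, dotProduct, hrow]
  have hmean : ∑ x, p x * (P *ᵥ f) x = 0 := by
    have := hsymm (fun _ => 1) f
    rw [hone] at this
    simpa [hf] using this
  refine ⟨hmean, ?_⟩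
  set g := P *ᵥ f with hg
  have hG : ∑ x, p x * f x * (P *ᵥ g) x = ∑ x, p x * g x ^ 2 := by
    rw [hsymm]
    exact Finset.sum_congr rfl fun x _ => by rw [← hg]; ring
  have hG' : ∑ x, p x * g x * (P *ᵥ f) x = ∑ x, p x * g x ^ 2 := by
    rw [← hsymm, hG]
  have expand : ∀ c : ℝ, ∑ x, p x * (f + c • g) x * (P *ᵥ (f + c • g)) x =
      ∑ x, p x * f x * (P *ᵥ f) x + 2 * c * ∑ x, p x * g x ^ 2 +
        c ^ 2 * ∑ x, p x * g x * (P *ᵥ g) x := by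
    intro c
    rw [two_mul, add_mul]
    nth_rewrite 1 [← hG]
    rw [← hG']
    simp only [Finset.mul_sum, ← Finset.sum_add_distrib]
    refine Finset.sum_congr rfl fun x _ => ?_
    rw [mulVec_add, mulVec_smul]
    simp only [Pi.add_apply, Pi.smul_apply, smul_eq_mul]
    ring
  have expand' : ∀ c : ℝ, ∑ x, p x * (f + c • g) x ^ 2 =
      ∑ x, p x * f x ^ 2 + 2 * c * ∑ x, p x * f x * g x + c ^ 2 * ∑ x, p x * g x ^ 2 := by
    intro c
    simp only [Finset.mul_sum, ← Finset.sum_add_distrib]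
    refine Finset.sum_congr rfl fun x _ => ?_
    simp only [Pi.add_apply, Pi.smul_apply, smul_eq_mul]
    ring
  have hmz : ∀ c : ℝ, ∑ x, p x * (f + c • g) x = 0 := by
    intro c
    have : ∑ x, p x * (f + c • g) x = ∑ x, p x * f x + c * ∑ x, p x * g x := by
      simp only [Finset.mul_sum, ← Finset.sum_add_distrib]
      refine Finset.sum_congr rfl fun x _ => ?_
      simp only [Pi.add_apply, Pi.smul_apply, smul_eq_mul]
      ring
    rw [this, hf, hmean, mul_zero, add_zero]
  have u1 := h1 _ (hmz lam⁻¹)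
  have u2 := h0 (f + (-lam⁻¹) • g)
  have u3 : 0 ≤ lam * ∑ x, p x * (f + (-lam⁻¹) • g) x ^ 2 :=
    mul_nonneg hlam.le (Finset.sum_nonneg fun x _ => mul_nonneg (hp x).le (sq_nonneg _))
  rw [expand, expand'] at u1
  rw [expand] at u2
  rw [expand'] at u3
  set F := ∑ x, p x * f x ^ 2
  set G := ∑ x, p x * g x ^ 2
  have h4 : 4 * lam⁻¹ * G ≤ 2 * lam * F + 2 * lam * lam⁻¹ ^ 2 * G := by nlinarith
  have h5 : lam * lam⁻¹ ^ 2 = lam⁻¹ := by field_simp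
  have h6 : lam⁻¹ * G ≤ lam * F := by
    have : 2 * lam * lam⁻¹ ^ 2 * G = 2 * lam⁻¹ * G := by rw [mul_assoc 2, h5]
    linarith
  have h7 := mul_le_mul_of_nonneg_left h6 hlam.le
  rw [← mul_assoc, mul_inv_cancel₀ hlam.ne', one_mul] at h7
  linarith

/-- The `ℓ²` bound on the distance to stationarity of a reversible chain. -/
theorem sum_abs_pow_sub_le [DecidableEq Ω] {p : Ω → ℝ} (hp : ∀ x, 0 < p x) (hsum : ∑ x, p x = 1)
    {P : Matrix Ω Ω ℝ}
    (hrev : ∀ x y, p x * P x y = p y * P y x) (hrow : ∀ x, ∑ y, P x y = 1)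
    {lam : ℝ} (hlam : 0 < lam)
    (h0 : ∀ f : Ω → ℝ, 0 ≤ ∑ x, p x * f x * (P *ᵥ f) x)
    (h1 : ∀ f : Ω → ℝ, ∑ x, p x * f x = 0 →
      ∑ x, p x * f x * (P *ᵥ f) x ≤ lam * ∑ x, p x * f x ^ 2) (t : ℕ) (x : Ω) :
    ∑ y, |(P ^ t) x y - p y| ≤ lam ^ t / √(p x) := by
  let g : Ω → ℝ := Pi.single x (p x)⁻¹ - fun _ => 1
  have hg0 : ∑ y, p y * g y = 0 := by
    simp [g, mul_sub, Finset.sum_sub_distrib, hsum, Pi.single_apply, (hp x).ne']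
  have hg1 : ∑ y, p y * g y ^ 2 ≤ (p x)⁻¹ := by
    have : ∀ y, p y * g y ^ 2 = (if y = x then (p x)⁻¹ - 2 else 0) + p y := by
      intro y
      by_cases h : y = x
      · subst h
        have := (hp y).ne'
        simp only [g, Pi.sub_apply, Pi.single_eq_same, if_true]
        field_simp
        ring
      · simp [g, h]
    simp only [this, Finset.sum_add_distrib, hsum]
    simp
    linarith
  have hiter : ∀ t : ℕ, ∑ y, p y * ((P ^ t) *ᵥ g) y = 0 ∧
      ∑ y, p y * ((P ^ t) *ᵥ g) y ^ 2 ≤ (lam ^ t) ^ 2 * (p x)⁻¹ := by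
    intro t
    induction t with
    | zero => simpa using ⟨hg0, hg1⟩
    | succ t ih =>
      have := sum_sq_mulVec_le hp hrev hrow hlam h0 h1 ih.1
      rw [pow_succ', ← mulVec_mulVec]
      refine ⟨this.1, this.2.trans ?_⟩
      rw [pow_succ' lam t, mul_pow, mul_assoc]
      exact mul_le_mul_of_nonneg_left ih.2 (sq_nonneg _)
  have hrevt : ∀ t : ℕ, ∀ a b, p a * (P ^ t) a b = p b * (P ^ t) b a := by
    intro t
    induction t with
    | zero =>
      intro a b
      by_cases h : a = b
      · subst h; rfl
      · simp [one_apply, h, Ne.symm h]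
    | succ t ih =>
      intro a b
      nth_rewrite 1 [pow_succ]
      rw [pow_succ', mul_apply, mul_apply, Finset.mul_sum, Finset.mul_sum]
      refine Finset.sum_congr rfl fun c _ => ?_
      rw [← mul_assoc, ih a c, mul_right_comm, hrev c b]
      ring
  have hrowt : ∀ t : ℕ, (P ^ t) *ᵥ (fun _ => (1 : ℝ)) = fun _ => 1 := by
    intro t
    induction t with
    | zero => simp
    | succ t ih =>
      rw [pow_succ', ← mulVec_mulVec, ih]
      funext x
      simp [mulVec, dotProduct, hrow]
  have hkey : ∀ y, (P ^ t) x y - p y = p y * ((P ^ t) *ᵥ g) y := by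
    intro y
    have e : ((P ^ t) *ᵥ g) y = (P ^ t) y x * (p x)⁻¹ - 1 := by
      simp only [g]
      rw [mulVec_sub, hrowt, Pi.sub_apply, mulVec_single]
      simp
    have := hrevt t x y
    have hx := (hp x).ne'
    rw [e, mul_sub, mul_one, ← mul_assoc, ← this]
    field_simp
  have hcs : (∑ y, |(P ^ t) x y - p y|) ^ 2 ≤ (lam ^ t / √(p x)) ^ 2 := by
    have h2 : ∑ y, |(P ^ t) x y - p y| = ∑ y, √(p y) * (√(p y) * |((P ^ t) *ᵥ g) y|) := by
      refine Finset.sum_congr rfl fun y _ => ?_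
      rw [hkey, abs_mul, abs_of_pos (hp y), ← mul_assoc, Real.mul_self_sqrt (hp y).le]
    rw [h2]
    refine (Finset.sum_mul_sq_le_sq_mul_sq _ _ _).trans ?_
    have h3 : ∑ y, √(p y) ^ 2 = 1 := by
      rw [← hsum]
      exact Finset.sum_congr rfl fun y _ => Real.sq_sqrt (hp y).le
    have h4 : ∑ y, (√(p y) * |((P ^ t) *ᵥ g) y|) ^ 2 = ∑ y, p y * ((P ^ t) *ᵥ g) y ^ 2 :=
      Finset.sum_congr rfl fun y _ => by rw [mul_pow, Real.sq_sqrt (hp y).le, sq_abs]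
    rw [h3, h4, one_mul, div_pow, Real.sq_sqrt (hp x).le, div_eq_mul_inv]
    exact (hiter t).2
  exact (sq_le_sq₀ (Finset.sum_nonneg fun _ _ => abs_nonneg _)
    (div_nonneg (pow_nonneg hlam.le _) (Real.sqrt_nonneg _))).1 hcs

/-- The kernel `min (p x) (p y)` is positive semidefinite. -/
theorem sum_min_mul_nonneg {ι : Type*} (s : Finset ι) (p f : ι → ℝ)
    (hp : ∀ i ∈ s, 0 ≤ p i) :
    0 ≤ ∑ i ∈ s, ∑ j ∈ s, min (p i) (p j) * (f i * f j) := by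
  classical
  induction s using Finset.strongInduction generalizing p with
  | H s ih =>
    rcases s.eq_empty_or_nonempty with rfl | hs
    · simp
    obtain ⟨a, ha, hmin⟩ := Finset.exists_min_image s p hs
    have hsplit : ∑ i ∈ s, ∑ j ∈ s, min (p i) (p j) * (f i * f j) =
        p a * (∑ i ∈ s, f i) ^ 2 +
          ∑ i ∈ s, ∑ j ∈ s, min (p i - p a) (p j - p a) * (f i * f j) := by
      rw [sq, Finset.sum_mul_sum, Finset.mul_sum, ← Finset.sum_add_distrib]
      refine Finset.sum_congr rfl fun i _ => ?_
      rw [Finset.mul_sum, ← Finset.sum_add_distrib]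
      refine Finset.sum_congr rfl fun j _ => ?_
      rw [min_sub_sub_right]
      ring
    have herase : ∑ i ∈ s, ∑ j ∈ s, min (p i - p a) (p j - p a) * (f i * f j) =
        ∑ i ∈ s.erase a, ∑ j ∈ s.erase a, min (p i - p a) (p j - p a) * (f i * f j) := by
      rw [← Finset.sum_erase s (a := a)]
      · refine Finset.sum_congr rfl fun i hi => ?_
        rw [← Finset.sum_erase s (a := a)]
        rw [sub_self, min_eq_right (sub_nonneg.2 (hmin i (Finset.mem_of_mem_erase hi))), zero_mul]
      · refine Finset.sum_eq_zero fun j hj => ?_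
        rw [sub_self, min_eq_left (sub_nonneg.2 (hmin j hj)), zero_mul]
    rw [hsplit, herase]
    exact add_nonneg (mul_nonneg (hp a ha) (sq_nonneg _))
      (ih _ (Finset.erase_ssubset ha) (fun i => p i - p a)
        fun i hi => sub_nonneg.2 (hmin i (Finset.mem_of_mem_erase hi)))

end ReversibleChain

section SingleSite

variable {ι : Type*} [Fintype ι] [DecidableEq ι] {n : ℕ}

/-- The configuration which follows `y` in the first `k` slots and `x` afterwards. -/
def splice (k : ℕ) (x y : Fin n → ι) : Fin n → ι := fun t => if t.val < k then y t else x t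

theorem splice_splice (k : ℕ) (x y : Fin n → ι) :
    splice k (splice k x y) (splice k y x) = x := by
  funext t
  by_cases h : t.val < k <;> simp [splice, h]

theorem splice_succ (k : Fin n) (x y : Fin n → ι) :
    splice (k.val + 1) x y = Function.update (splice k.val x y) k (splice k.val y x k) := by
  funext t
  rcases lt_trichotomy t k with h | h | h
  · have h1 : t.val < k.val := h
    simp [splice, h.ne, h1, Nat.lt_succ_of_lt h1]
  · subst h
    simp [splice]
  · have h1 : k.val < t.val := h
    simp [splice, h.ne', not_lt.2 h1.le, not_lt.2 (Nat.succ_le_of_lt h1)]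

/-- Resampling a slot and remembering the old value is an involution. -/
def updateEquiv (k : Fin n) : (Fin n → ι) × ι ≃ (Fin n → ι) × ι where
  toFun a := (Function.update a.1 k a.2, a.1 k)
  invFun a := (Function.update a.1 k a.2, a.1 k)
  left_inv a := by simp
  right_inv a := by simp

theorem sum_update_comm (k : Fin n) (φ : (Fin n → ι) → (Fin n → ι) → ℝ) :
    ∑ x, ∑ o, φ (Function.update x k o) x = ∑ x, ∑ o, φ x (Function.update x k o) := by
  rw [← Fintype.sum_prod_type', ← Fintype.sum_prod_type',
    ← (updateEquiv k).sum_comp fun a : (Fin n → ι) × ι => φ (Function.update a.1 k a.2) a.1]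
  refine Finset.sum_congr rfl fun a _ => ?_
  simp [updateEquiv]

theorem sum_sum_update (k : Fin n) (F : (Fin n → ι) → ℝ) :
    ∑ x, ∑ o, F (Function.update x k o) = Fintype.card ι * ∑ x, F x := by
  rw [sum_update_comm k fun a _ => F a]
  simp [Finset.mul_sum]

variable {p : (Fin n → ι) → ℝ}

theorem sum_min_update_nonneg (hp : ∀ x, 0 < p x) (k : Fin n) (f : (Fin n → ι) → ℝ) :
    0 ≤ ∑ x, ∑ o, min (p x) (p (Function.update x k o)) * (f x * f (Function.update x k o)) := by
  rcases isEmpty_or_nonempty ι with h | h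
  · simp
  have h1 := sum_sum_update k fun x : Fin n → ι =>
    ∑ o, min (p x) (p (Function.update x k o)) * (f x * f (Function.update x k o))
  simp only [Function.update_idem] at h1
  have h2 : 0 ≤ (Fintype.card ι : ℝ) * ∑ x, ∑ o,
      min (p x) (p (Function.update x k o)) * (f x * f (Function.update x k o)) := by
    rw [← h1]
    exact Finset.sum_nonneg fun x _ => sum_min_mul_nonneg Finset.univ
      (fun o => p (Function.update x k o)) (fun o => f (Function.update x k o))
      fun o _ => (hp _).le
  exact nonneg_of_mul_nonneg_right h2 (by exact_mod_cast Fintype.card_pos)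

/-- The (unnormalized) Dirichlet form of the single-site Metropolis dynamics. -/
noncomputable def dirichlet (p f : (Fin n → ι) → ℝ) : ℝ :=
  ∑ x, ∑ k, ∑ o, min (p x) (p (Function.update x k o)) * (f (Function.update x k o) - f x) ^ 2

theorem sum_mul_min_sub (f : (Fin n → ι) → ℝ) (k : Fin n) :
    ∑ x, ∑ o, min (p x) (p (Function.update x k o)) * (f x * (f (Function.update x k o) - f x)) =
      -(1 / 2) * ∑ x, ∑ o, min (p x) (p (Function.update x k o)) *
        (f (Function.update x k o) - f x) ^ 2 := by
  have h := sum_update_comm k fun a b => min (p a) (p b) * f a ^ 2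
  have h' : ∑ x, ∑ o, (min (p x) (p (Function.update x k o)) * f (Function.update x k o) ^ 2 -
      min (p x) (p (Function.update x k o)) * f x ^ 2) = 0 := by
    simp only [Finset.sum_sub_distrib]
    rw [sub_eq_zero, ← h]
    simp only [min_comm]
  rw [← sub_eq_zero]
  rw [← mul_zero (1 / 2 : ℝ), ← h']
  simp only [Finset.mul_sum, ← Finset.sum_sub_distrib]
  refine Finset.sum_congr rfl fun x _ => Finset.sum_congr rfl fun o _ => ?_
  ring

/-- The telescoping (canonical path) bound on the variance by the Dirichlet form. -/
theorem variance_le_dirichlet (hp : ∀ x, 0 < p x) {K M : ℝ} (hK : 0 ≤ K)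
    (hex : ∀ x y : Fin n → ι, ∀ k ≤ n, p x * p y ≤ K * (p (splice k x y) * p (splice k y x)))
    (hM : ∀ (k : Fin n) (o q : ι), o ≠ q →
      ∑ z with z k = o, (p z + p (Function.update z k q)) ≤ M) (f : (Fin n → ι) → ℝ) :
    ∑ x, ∑ y, p x * p y * (f y - f x) ^ 2 ≤ n * (K * M) * dirichlet p f := by
  have htel : ∀ x y : Fin n → ι, (f y - f x) ^ 2 ≤
      n * ∑ k : Fin n, (f (splice (k.val + 1) x y) - f (splice k.val x y)) ^ 2 := by
    intro x y
    have e0 : splice 0 x y = x := by funext t; simp [splice]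
    have en : splice n x y = y := by funext t; simp [splice]
    have h1 : f y - f x =
        ∑ k : Fin n, (f (splice (k.val + 1) x y) - f (splice k.val x y)) := by
      rw [Fin.sum_univ_eq_sum_range fun k => f (splice (k + 1) x y) - f (splice k x y),
        Finset.sum_range_sub fun k => f (splice k x y), e0, en]
    rw [h1]
    refine sq_sum_le_card_mul_sum_sq.trans ?_
    simp
  have hstep : ∀ k : Fin n,
      ∑ x, ∑ y, p x * p y * (f (splice (k.val + 1) x y) - f (splice k.val x y)) ^ 2 ≤
        K * M * ∑ x, ∑ o, min (p x) (p (Function.update x k o)) *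
          (f (Function.update x k o) - f x) ^ 2 := by
    intro k
    let H : (Fin n → ι) × (Fin n → ι) → ℝ := fun a =>
      K * min (p a.1) (p (Function.update a.1 k (a.2 k))) *
        (f (Function.update a.1 k (a.2 k)) - f a.1) ^ 2 *
          (p a.2 + p (Function.update a.2 k (a.1 k)))
    let σ : (Fin n → ι) × (Fin n → ι) ≃ (Fin n → ι) × (Fin n → ι) :=
      { toFun := fun a => (splice k.val a.1 a.2, splice k.val a.2 a.1)
        invFun := fun a => (splice k.val a.1 a.2, splice k.val a.2 a.1)
        left_inv := fun a => by simp [splice_splice]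
        right_inv := fun a => by simp [splice_splice] }
    have hle : ∑ x, ∑ y, p x * p y * (f (splice (k.val + 1) x y) - f (splice k.val x y)) ^ 2 ≤
        ∑ x, ∑ y, H (σ (x, y)) := by
      refine Finset.sum_le_sum fun x _ => Finset.sum_le_sum fun y _ => ?_
      have h1 := hex x y k.val k.2.le
      have h2 := hex x y (k.val + 1) k.2
      simp only [H, σ, Equiv.coe_fn_mk]
      rw [splice_succ, splice_succ] at h2
      rw [splice_succ]
      set z := splice k.val x y
      set z' := splice k.val y x
      rw [mul_right_comm (K * _)]
      refine mul_le_mul_of_nonneg_right ?_ (sq_nonneg _)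
      rw [mul_assoc K]
      have a1 := (hp z').le
      have a2 := (hp (Function.update z' k (z k))).le
      have a3 := (hp z).le
      have a4 := (hp (Function.update z k (z' k))).le
      rcases le_total (p z) (p (Function.update z k (z' k))) with h | h
      · rw [min_eq_left h]
        exact h1.trans (mul_le_mul_of_nonneg_left (by nlinarith) hK)
      · rw [min_eq_right h]
        exact h2.trans (mul_le_mul_of_nonneg_left (by nlinarith) hK)
    refine hle.trans ?_
    rw [← Fintype.sum_prod_type', σ.sum_comp H, Fintype.sum_prod_type, Finset.mul_sum]
    refine Finset.sum_le_sum fun z _ => ?_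
    rw [← Finset.sum_fiberwise Finset.univ (fun z' : Fin n → ι => z' k), Finset.mul_sum]
    refine Finset.sum_le_sum fun o _ => ?_
    have h3 : ∑ z' with z' k = o, H (z, z') =
        K * min (p z) (p (Function.update z k o)) * (f (Function.update z k o) - f z) ^ 2 *
          ∑ z' with z' k = o, (p z' + p (Function.update z' k (z k))) := by
      rw [Finset.mul_sum]
      refine Finset.sum_congr rfl fun z' hz' => ?_
      simp only [Finset.mem_filter, Finset.mem_univ, true_and] at hz'
      simp only [H, hz']
    rw [h3]
    by_cases ho : o = z k
    · subst ho
      simp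
    · have h4 := hM k o (z k) ho
      have h5 : 0 ≤ K * min (p z) (p (Function.update z k o)) *
          (f (Function.update z k o) - f z) ^ 2 :=
        mul_nonneg (mul_nonneg hK (le_min (hp _).le (hp _).le)) (sq_nonneg _)
      refine (mul_le_mul_of_nonneg_left h4 h5).trans (le_of_eq ?_)
      ring
  calc ∑ x, ∑ y, p x * p y * (f y - f x) ^ 2
      ≤ ∑ x, ∑ y, p x * p y * (n * ∑ k : Fin n,
          (f (splice (k.val + 1) x y) - f (splice k.val x y)) ^ 2) :=
        Finset.sum_le_sum fun x _ => Finset.sum_le_sum fun y _ =>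
          mul_le_mul_of_nonneg_left (htel x y) (mul_pos (hp x) (hp y)).le
    _ = n * ∑ k : Fin n, ∑ x, ∑ y,
          p x * p y * (f (splice (k.val + 1) x y) - f (splice k.val x y)) ^ 2 := by
        rw [Finset.sum_comm (s := (Finset.univ : Finset (Fin n))), Finset.mul_sum]
        refine Finset.sum_congr rfl fun x _ => ?_
        rw [Finset.sum_comm, Finset.mul_sum]
        refine Finset.sum_congr rfl fun y _ => ?_
        rw [← Finset.mul_sum]
        ring
    _ ≤ n * ∑ k : Fin n, (K * M * ∑ x, ∑ o, min (p x) (p (Function.update x k o)) *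
          (f (Function.update x k o) - f x) ^ 2) :=
        mul_le_mul_of_nonneg_left (Finset.sum_le_sum fun k _ => hstep k) (Nat.cast_nonneg n)
    _ = n * (K * M) * dirichlet p f := by
        rw [dirichlet, Finset.sum_comm (s := (Finset.univ : Finset (Fin n → ι))),
          ← Finset.mul_sum, mul_assoc (n : ℝ)]

theorem sum_filter_update (k : Fin n) (o q : ι) :
    ∑ z with z k = o, p (Function.update z k q) = ∑ z with z k = q, p z := by
  refine Finset.sum_nbij' (fun z => Function.update z k q) (fun z => Function.update z k o)
    ?_ ?_ ?_ ?_ ?_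
  · simp
  · simp
  · intro z hz
    simp only [Finset.mem_filter, Finset.mem_univ, true_and] at hz
    simp [← hz]
  · intro z hz
    simp only [Finset.mem_filter, Finset.mem_univ, true_and] at hz
    simp [← hz]
  · simp

theorem sum_filter_add_le_one (hp : ∀ x, 0 < p x) (hsum : ∑ x, p x = 1) (k : Fin n) (o q : ι)
    (hoq : o ≠ q) : ∑ z with z k = o, (p z + p (Function.update z k q)) ≤ 1 := by
  rw [Finset.sum_add_distrib, sum_filter_update, ← hsum,
    ← Finset.sum_fiberwise Finset.univ (fun z : Fin n → ι => z k)]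
  have h := Finset.add_le_sum (s := Finset.univ)
    (f := fun j => ∑ z : Fin n → ι with z k = j, p z) (i := o) (j := q)
    (fun _ _ => Finset.sum_nonneg fun _ _ => (hp _).le)
    (Finset.mem_univ _) (Finset.mem_univ _) hoq
  exact h

theorem card_mul_sum_filter_le (hsum : ∑ x, p x = 1) {D : ℝ}
    (hD : ∀ (x : Fin n → ι) (k : Fin n) (o q : ι),
      p (Function.update x k o) ≤ D * p (Function.update x k q)) (k : Fin n) (o : ι) :
    Fintype.card ι * ∑ z with z k = o, p z ≤ D := by
  have h1 : ∑ j, ∑ z with z k = j, p z = 1 := by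
    rw [Finset.sum_fiberwise, hsum]
  have h2 : ∀ j, ∑ z with z k = o, p z ≤ D * ∑ z with z k = j, p z := by
    intro j
    rw [← sum_filter_update k o j, Finset.mul_sum]
    refine Finset.sum_le_sum fun z hz => ?_
    simp only [Finset.mem_filter, Finset.mem_univ, true_and] at hz
    have := hD z k o j
    rwa [← hz, Function.update_eq_self] at this
  calc (Fintype.card ι : ℝ) * ∑ z with z k = o, p z
      = ∑ _j : ι, ∑ z with z k = o, p z := by simp
    _ ≤ ∑ j, D * ∑ z with z k = j, p z := Finset.sum_le_sum fun j _ => h2 j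
    _ = D := by rw [← Finset.mul_sum, h1, mul_one]

theorem card_mul_sum_filter_add_le (hsum : ∑ x, p x = 1) {D : ℝ}
    (hD : ∀ (x : Fin n → ι) (k : Fin n) (o q : ι),
      p (Function.update x k o) ≤ D * p (Function.update x k q)) (k : Fin n) (o q : ι) :
    Fintype.card ι * ∑ z with z k = o, (p z + p (Function.update z k q)) ≤ 2 * D := by
  rw [Finset.sum_add_distrib, sum_filter_update, mul_add]
  linarith [card_mul_sum_filter_le hsum hD k o, card_mul_sum_filter_le hsum hD k q]

open Matrix in
/-- Mixing of the single-site Metropolis chain with uniform proposals. -/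
theorem metropolis_sum_abs_le (hp : ∀ x, 0 < p x) (hsum : ∑ x, p x = 1)
    {P : Matrix (Fin n → ι) (Fin n → ι) ℝ} {c : ℝ} (hc : 0 < c)
    (hcn : c * (n * Fintype.card ι) ≤ 1)
    (hrev : ∀ x y, p x * P x y = p y * P y x)
    (hP : ∀ (f : (Fin n → ι) → ℝ) x, p x * (P *ᵥ f) x = p x * f x +
      c * ∑ k, ∑ o, min (p x) (p (Function.update x k o)) * (f (Function.update x k o) - f x))
    {K M ρ : ℝ} (hK : 0 ≤ K)
    (hex : ∀ x y : Fin n → ι, ∀ k ≤ n, p x * p y ≤ K * (p (splice k x y) * p (splice k y x)))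
    (hM : ∀ (k : Fin n) (o q : ι), o ≠ q →
      ∑ z with z k = o, (p z + p (Function.update z k q)) ≤ M)
    (hρ : n * (K * M) ≤ ρ * c) (hρ1 : 1 < ρ) (t : ℕ) (x : Fin n → ι) :
    ∑ y, |(P ^ t) x y - p y| ≤ (1 - ρ⁻¹) ^ t / √(p x) := by
  have hρ0 : 0 < ρ := by linarith
  have hrow : ∀ x, ∑ y, P x y = 1 := by
    intro x
    have := hP (fun _ => 1) x
    simp only [sub_self, mul_zero, Finset.sum_const_zero, add_zero] at this
    have := mul_left_cancel₀ (hp x).ne' this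
    simpa [mulVec, dotProduct] using this
  have hsplit : ∀ f : (Fin n → ι) → ℝ, ∑ x, p x * f x * (P *ᵥ f) x = ∑ x, p x * f x ^ 2 +
      c * ∑ k, ∑ x, ∑ o, min (p x) (p (Function.update x k o)) *
        (f x * (f (Function.update x k o) - f x)) := by
    intro f
    rw [Finset.sum_comm, Finset.mul_sum, ← Finset.sum_add_distrib]
    refine Finset.sum_congr rfl fun x _ => ?_
    have := hP f x
    rw [mul_right_comm, this, add_mul, mul_assoc c, Finset.sum_mul]
    simp only [Finset.sum_mul]
    congr 1
    · ring
    · congr 1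
      refine Finset.sum_congr rfl fun k _ => Finset.sum_congr rfl fun o _ => ?_
      ring
  have hform : ∀ f : (Fin n → ι) → ℝ, ∑ x, p x * f x * (P *ᵥ f) x =
      ∑ x, p x * f x ^ 2 - c / 2 * dirichlet p f := by
    intro f
    rw [hsplit, dirichlet, Finset.sum_comm (s := (Finset.univ : Finset (Fin n → ι)))]
    simp only [sum_mul_min_sub]
    rw [← Finset.mul_sum]
    ring
  have hinv : ρ⁻¹ < 1 := inv_lt_one_of_one_lt₀ hρ1
  refine sum_abs_pow_sub_le hp hsum hrev hrow (by linarith) ?_ ?_ t x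
  · intro f
    rw [hsplit]
    have hS : 0 ≤ ∑ x, p x * f x ^ 2 :=
      Finset.sum_nonneg fun x _ => mul_nonneg (hp x).le (sq_nonneg _)
    have h1 : ∀ k : Fin n, -(Fintype.card ι * ∑ x, p x * f x ^ 2) ≤
        ∑ x, ∑ o, min (p x) (p (Function.update x k o)) *
          (f x * (f (Function.update x k o) - f x)) := by
      intro k
      have h2 := sum_min_update_nonneg hp k f
      have h3 : ∑ x, ∑ o, min (p x) (p (Function.update x k o)) * f x ^ 2 ≤
          Fintype.card ι * ∑ x, p x * f x ^ 2 := by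
        rw [Finset.mul_sum]
        refine Finset.sum_le_sum fun x _ => ?_
        rw [← Finset.sum_mul, ← mul_assoc]
        refine mul_le_mul_of_nonneg_right ?_ (sq_nonneg _)
        refine (Finset.sum_le_sum fun o _ => min_le_left _ _).trans ?_
        simp
      have h4 : ∑ x, ∑ o, min (p x) (p (Function.update x k o)) *
          (f x * (f (Function.update x k o) - f x)) =
          ∑ x, ∑ o, min (p x) (p (Function.update x k o)) * (f x * f (Function.update x k o)) -
            ∑ x, ∑ o, min (p x) (p (Function.update x k o)) * f x ^ 2 := by
        simp only [← Finset.sum_sub_distrib]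
        refine Finset.sum_congr rfl fun x _ => Finset.sum_congr rfl fun o _ => ?_
        ring
      rw [h4]
      linarith
    have h5 : -(n * (Fintype.card ι * ∑ x, p x * f x ^ 2)) ≤
        ∑ k : Fin n, ∑ x, ∑ o, min (p x) (p (Function.update x k o)) *
          (f x * (f (Function.update x k o) - f x)) := by
      refine le_trans (le_of_eq ?_) (Finset.sum_le_sum fun k _ => h1 k)
      simp
    have h6 := mul_le_mul_of_nonneg_left h5 hc.le
    have h7 := mul_le_mul_of_nonneg_right hcn hS
    nlinarith
  · intro f hf
    rw [hform]
    have h1 := variance_le_dirichlet hp hK hex hM f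
    have h2 : ∑ x, ∑ y, p x * p y * (f y - f x) ^ 2 = 2 * ∑ x, p x * f x ^ 2 := by
      have e : ∀ x y, p x * p y * (f y - f x) ^ 2 =
          p x * (p y * f y ^ 2) + p x * f x ^ 2 * p y - 2 * (p x * f x) * (p y * f y) := by
        intro x y; ring
      simp only [e, Finset.sum_sub_distrib, Finset.sum_add_distrib, ← Finset.mul_sum, hf, hsum,
        ← Finset.sum_mul]
      ring
    have hE : 0 ≤ dirichlet p f := Finset.sum_nonneg fun x _ => Finset.sum_nonneg fun k _ =>
      Finset.sum_nonneg fun o _ => mul_nonneg (le_min (hp _).le (hp _).le) (sq_nonneg _)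
    have h3 := mul_le_mul_of_nonneg_right hρ hE
    have h4 : ρ⁻¹ * ∑ x, p x * f x ^ 2 ≤ c / 2 * dirichlet p f := by
      rw [inv_mul_le_iff₀ hρ0]
      linarith
    linarith

end SingleSite

section MixingTime

/-- The number of steps after which the `ℓ²` bound falls below one half. -/
theorem exists_steps_le {B a N m : ℕ} (hB : 0 < B) (ha : 1 ≤ a) (hm : 1 ≤ m) (hmN : m ≤ 3 * N)
    {R τ : ℝ} (hR : 1 ≤ R) (hτ : 1 ≤ τ) :
    ∃ t : ℕ, (t : ℝ) ≤ 24 * (B : ℝ) ^ 3 * N * R * 2 ^ (8 * a - 4) * Real.log (8 * τ) ∧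
      (1 - (4 * (B : ℝ) ^ 2 * 2 ^ (2 * a) * min (m : ℝ) (32 * R))⁻¹) ^ t * (4 * m * R) ^ B ≤
        1 / 2 := by
  have hB1 : (1 : ℝ) ≤ B := by exact_mod_cast hB
  have hm1 : (1 : ℝ) ≤ m := by exact_mod_cast hm
  have hmN' : (m : ℝ) ≤ 3 * N := by exact_mod_cast hmN
  have hmR : 1 ≤ m * R := one_le_mul_of_one_le_of_one_le hm1 hR
  obtain ⟨s, hs1, hs⟩ : ∃ s : ℝ, 1 ≤ s ∧ s ^ 2 = m * R :=
    ⟨√(m * R), Real.one_le_sqrt.2 hmR, Real.sq_sqrt (by linarith)⟩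
  set q := min (m : ℝ) (32 * R) with hq
  have hq1 : 1 ≤ q := le_min hm1 (by linarith)
  have hqs : q ≤ 6 * s := by
    have h1 : q * q ≤ m * (32 * R) :=
      mul_le_mul (min_le_left _ _) (min_le_right _ _) (by linarith) (by linarith)
    nlinarith
  set w : ℝ := 2 ^ (2 * a) with hw
  have hw4 : 4 ≤ w := by
    calc (4 : ℝ) = 2 ^ 2 := by norm_num
      _ ≤ w := pow_le_pow_right₀ (by norm_num) (by omega)
  have hw2 : w ^ 2 ≤ 2 ^ (8 * a - 4) := by
    rw [hw, ← pow_mul]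
    exact pow_le_pow_right₀ (by norm_num) (by omega)
  set ρ := 4 * (B : ℝ) ^ 2 * w * q with hρ
  have hB2 : 1 ≤ (B : ℝ) ^ 2 := one_le_pow₀ hB1
  have hρ1 : 1 < ρ := by
    have : 1 ≤ (B : ℝ) ^ 2 * w * q :=
      one_le_mul_of_one_le_of_one_le (one_le_mul_of_one_le_of_one_le hB2 (by linarith)) hq1
    rw [hρ, mul_assoc, mul_assoc, ← mul_assoc ((B : ℝ) ^ 2)]
    linarith
  have hρs : ρ ≤ 6 * (B : ℝ) ^ 2 * w ^ 2 * s := by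
    have h1 : w * q ≤ w * (6 * s) := mul_le_mul_of_nonneg_left hqs (by linarith)
    have h2 : 4 * (w * (6 * s)) ≤ 6 * w ^ 2 * s := by
      have : 0 ≤ 6 * w * s * (w - 4) := by
        have := mul_nonneg (mul_nonneg (by linarith : (0 : ℝ) ≤ 6 * w) (by linarith : 0 ≤ s))
          (sub_nonneg.2 hw4)
        exact this
      nlinarith
    calc ρ = (B : ℝ) ^ 2 * (4 * (w * q)) := by rw [hρ]; ring
      _ ≤ (B : ℝ) ^ 2 * (6 * w ^ 2 * s) :=
        mul_le_mul_of_nonneg_left (by linarith) (by positivity)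
      _ = _ := by ring
  set Λ := B * Real.log (4 * m * R) + Real.log 2 with hΛ
  have hl2 := Real.log_two_gt_d9
  have hl2' := Real.log_two_lt_d9
  have hlog : Real.log (4 * m * R) ≤ 2 * Real.log 2 + 2 * (s - 1) := by
    have h1 : (4 : ℝ) * m * R = 2 ^ 2 * s ^ 2 := by rw [hs]; ring
    rw [h1, Real.log_mul (by norm_num) (by positivity), Real.log_pow, Real.log_pow]
    have := Real.log_le_sub_one_of_pos (by linarith : 0 < s)
    push_cast
    linarith
  have hlog0 : 0 ≤ Real.log (4 * m * R) := Real.log_nonneg (by linarith)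
  have hΛ0 : 0 ≤ Λ := by positivity
  have hΛs : Λ ≤ B * (2 * s + 0.08) := by
    have h1 : Λ ≤ B * (2 * Real.log 2 + 2 * (s - 1)) + B * Real.log 2 := by
      rw [hΛ]
      have := mul_le_mul_of_nonneg_left hlog (by linarith : (0 : ℝ) ≤ B)
      nlinarith
    refine h1.trans ?_
    rw [← mul_add]
    refine mul_le_mul_of_nonneg_left ?_ (by linarith)
    linarith
  have hlogτ : 3 * Real.log 2 ≤ Real.log (8 * τ) := by
    have : 3 * Real.log 2 = Real.log 8 := by
      rw [show (8 : ℝ) = 2 ^ 3 by norm_num, Real.log_pow]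
      norm_num
    rw [this]
    exact Real.log_le_log (by norm_num) (by linarith)
  refine ⟨⌈ρ * Λ⌉₊, ?_, ?_⟩
  · have h1 : (⌈ρ * Λ⌉₊ : ℝ) ≤ ρ * Λ + 1 := (Nat.ceil_lt_add_one (by positivity)).le
    have h2 : ρ * Λ ≤ (6 * (B : ℝ) ^ 2 * w ^ 2 * s) * (B * (2 * s + 0.08)) :=
      mul_le_mul hρs hΛs hΛ0 (by positivity)
    have h3 : 1 ≤ (B : ℝ) ^ 3 * w ^ 2 * s * (1 / 16) := by
      have e1 : 1 ≤ (B : ℝ) ^ 3 := one_le_pow₀ hB1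
      have e2 : 16 ≤ w ^ 2 := by nlinarith
      have e3 : 1 ≤ (B : ℝ) ^ 3 * (w ^ 2 / 16) * s :=
        one_le_mul_of_one_le_of_one_le
          (one_le_mul_of_one_le_of_one_le e1 (by linarith)) hs1
      linarith
    have h4 : 8 * (B : ℝ) ^ 3 * s ^ 2 * w ^ 2 * (3 * Real.log 2) ≤
        24 * (B : ℝ) ^ 3 * N * R * 2 ^ (8 * a - 4) * Real.log (8 * τ) := by
      refine mul_le_mul ?_ hlogτ (by positivity) (by positivity)
      refine mul_le_mul ?_ hw2 (by positivity) (by positivity)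
      have : s ^ 2 ≤ 3 * N * R := by
        rw [hs]
        exact mul_le_mul_of_nonneg_right hmN' (by linarith)
      calc 8 * (B : ℝ) ^ 3 * s ^ 2 ≤ 8 * (B : ℝ) ^ 3 * (3 * N * R) :=
            mul_le_mul_of_nonneg_left this (by positivity)
        _ = _ := by ring
    refine h1.trans (le_trans ?_ h4)
    have h5 : 12 * s + 0.48 + 1 / 16 ≤ 24 * Real.log 2 * s := by nlinarith
    have h6 := mul_le_mul_of_nonneg_left h5
      (by positivity : 0 ≤ (B : ℝ) ^ 3 * w ^ 2 * s)
    nlinarith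
  · have h1 : 1 - ρ⁻¹ ≤ Real.exp (-ρ⁻¹) := by linarith [Real.add_one_le_exp (-ρ⁻¹)]
    have h2 : 0 ≤ 1 - ρ⁻¹ := by linarith [inv_lt_one_of_one_lt₀ hρ1]
    have h3 : (1 - ρ⁻¹) ^ ⌈ρ * Λ⌉₊ ≤ Real.exp (-Λ) := by
      refine (pow_le_pow_left₀ h2 h1 _).trans ?_
      rw [← Real.exp_nat_mul]
      refine Real.exp_le_exp.2 ?_
      have h4 := mul_le_mul_of_nonneg_right (Nat.le_ceil (ρ * Λ))
        (inv_nonneg.2 (by linarith : (0 : ℝ) ≤ ρ))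
      have h5 : ρ * Λ * ρ⁻¹ = Λ := by field_simp
      linarith
    have h4 : Real.exp (-Λ) * (4 * m * R) ^ B = 1 / 2 := by
      rw [hΛ, neg_add, Real.exp_add, Real.exp_neg, Real.exp_neg, Real.exp_nat_mul,
        Real.exp_log (by linarith), Real.exp_log (by norm_num)]
      have : (4 * m * R) ^ B ≠ 0 := by positivity
      field_simp
    rw [← h4]
    exact mul_le_mul_of_nonneg_right h3 (by positivity)

theorem sum_update_eq_sum_ite {ι : Type*} [Fintype ι] [DecidableEq ι] {n : ℕ} (x : Fin n → ι)
    (h : (Fin n → ι) → ℝ) (hx : h x = 0) :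
    ∑ k, ∑ o, h (Function.update x k o) =
      ∑ y, if x ≠ y ∧ ∃ k, ∀ j, j ≠ k → x j = y j then h y else 0 := by
  have h1 : ∀ k o, h (Function.update x k o) =
      ∑ y, if Function.update x k o = y then h y else 0 := by simp
  simp only [h1]
  refine ((Finset.sum_congr rfl fun k _ => Finset.sum_comm).trans Finset.sum_comm).trans ?_
  refine Finset.sum_congr rfl fun y _ => ?_
  split_ifs with hy
  · obtain ⟨hxy, k, hk⟩ := hy
    have hup : Function.update x k (y k) = y := by
      funext j
      by_cases hj : j = k
      · subst hj; simp
      · simp [hj, hk j hj]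
    rw [Finset.sum_eq_single k, Finset.sum_eq_single (y k), if_pos hup]
    · intro o _ ho
      refine if_neg fun e => ho ?_
      rw [← e, Function.update_self]
    · simp
    · intro k' _ hk'
      refine Finset.sum_eq_zero fun o _ => if_neg fun e => hxy ?_
      have : x k = y k := by rw [← e, Function.update_of_ne hk'.symm]
      rw [← hup, ← this, Function.update_eq_self]
    · simp
  · refine Finset.sum_eq_zero fun k _ => Finset.sum_eq_zero fun o _ => ?_
    split_ifs with e
    · by_cases hxy : x = y
      · rw [← hxy, hx]
      · exact absurd ⟨hxy, k, fun j hj => by rw [← e, Function.update_of_ne hj]⟩ hy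
    · rfl

variable {E EF O : Finset (Finset V)} {B : ℕ} {T : {e : Finset V // e ∈ O} → ℝ}

theorem confWt_pos (hT : ∀ o, 0 < T o) (x : Fin (2 * B) → {e : Finset V // e ∈ O}) :
    0 < confWt E EF O B T x :=
  mul_pos (by positivity) (Finset.prod_pos fun k _ => hT _)

theorem sum_confWt_pos (hT : ∀ o, 0 < T o) (x : Fin (2 * B) → {e : Finset V // e ∈ O}) :
    0 < ∑ y : Fin (2 * B) → {e : Finset V // e ∈ O}, confWt E EF O B T y :=
  Finset.sum_pos (fun y _ => confWt_pos hT y) ⟨x, Finset.mem_univ x⟩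

theorem piDist_pos (hT : ∀ o, 0 < T o) (x : Fin (2 * B) → {e : Finset V // e ∈ O}) :
    0 < piDist E EF O B T x :=
  div_pos (confWt_pos hT x) (sum_confWt_pos hT x)

theorem sum_piDist (hT : ∀ o, 0 < T o) (x : Fin (2 * B) → {e : Finset V // e ∈ O}) :
    ∑ y, piDist E EF O B T y = 1 := by
  simp only [piDist]
  rw [← Finset.sum_div, div_self (sum_confWt_pos hT x).ne']

theorem piDist_mul_offDiag (hT : ∀ o, 0 < T o)
    (x y : Fin (2 * B) → {e : Finset V // e ∈ O}) :
    piDist E EF O B T x * offDiag E EF O B T x y =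
      if x ≠ y ∧ ∃ k, ∀ j, j ≠ k → x j = y j then
        1 / (2 * B * O.card) * min (piDist E EF O B T x) (piDist E EF O B T y)
      else 0 := by
  have hx := piDist_pos (E := E) (EF := EF) hT x
  unfold offDiag
  split_ifs
  · rw [mul_left_comm, mul_min_of_nonneg _ _ hx.le, mul_one, mul_div_cancel₀ _ hx.ne']
  · rw [mul_zero]

theorem piDist_mul_transMat_comm (hT : ∀ o, 0 < T o)
    (x y : Fin (2 * B) → {e : Finset V // e ∈ O}) :
    piDist E EF O B T x * transMat E EF O B T x y =
      piDist E EF O B T y * transMat E EF O B T y x := by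
  by_cases h : x = y
  · rw [h]
  · simp only [transMat, Matrix.of_apply, transP, h, Ne.symm h, if_false, piDist_mul_offDiag hT,
      ne_comm (a := y), min_comm (piDist E EF O B T y), eq_comm (a := y _)]

open Matrix in
theorem piDist_mul_transMat_mulVec (hT : ∀ o, 0 < T o)
    (f : (Fin (2 * B) → {e : Finset V // e ∈ O}) → ℝ)
    (x : Fin (2 * B) → {e : Finset V // e ∈ O}) :
    piDist E EF O B T x * (transMat E EF O B T *ᵥ f) x = piDist E EF O B T x * f x +
      1 / (2 * B * O.card) * ∑ k, ∑ o,
        min (piDist E EF O B T x) (piDist E EF O B T (Function.update x k o)) *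
          (f (Function.update x k o) - f x) := by
  have h0 : offDiag E EF O B T x x = 0 := by simp [offDiag]
  have h1 : (transMat E EF O B T *ᵥ f) x =
      f x + ∑ y, offDiag E EF O B T x y * (f y - f x) := by
    have e : ∀ y, transMat E EF O B T x y * f y =
        (if x = y then (1 - ∑ y', offDiag E EF O B T x y') * f x else 0) +
          offDiag E EF O B T x y * f y := by
      intro y
      simp only [transMat, Matrix.of_apply, transP]
      split_ifs with h
      · rw [← h, h0, zero_mul, add_zero]
      · rw [zero_add]
    simp only [mulVec, dotProduct, e, mul_sub, Finset.sum_add_distrib, Finset.sum_sub_distrib,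
      ← Finset.sum_mul]
    simp
    ring
  rw [sum_update_eq_sum_ite x (fun y => min (piDist E EF O B T x) (piDist E EF O B T y) *
    (f y - f x)) (by simp), h1, mul_add, Finset.mul_sum, Finset.mul_sum]
  congr 1
  refine Finset.sum_congr rfl fun y _ => ?_
  rw [← mul_assoc, piDist_mul_offDiag hT]
  split_ifs
  · rw [mul_assoc]
  · simp

theorem isAllowed_of_mem {A : Finset V} {VX : Finset V}
    (hE : ∀ e ∈ E, ∃ i j : V, i ∈ A ∧ j ∉ A ∧ e = {i, j})
    (hEF : ∀ e ∈ EF, ∃ i j : V, i ≠ j ∧ ((i ∈ A ∧ j ∈ A) ∨ (i ∉ A ∧ j ∉ A)) ∧ e = {i, j})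
    (hO : O = E ∪ EF ∪ VX.image (fun i => ({i} : Finset V))) {o : Finset V} (ho : o ∈ O) :
    IsAllowed A E EF o := by
  have hdisj : ∀ e ∈ E, e ∉ EF := by
    intro e he he'
    obtain ⟨i, j, hi, hj, rfl⟩ := hE e he
    obtain ⟨i', j', _, h', heq⟩ := hEF _ he'
    have hi' : i ∈ ({i', j'} : Finset V) := by rw [← heq]; simp
    have hj' : j ∈ ({i', j'} : Finset V) := by rw [← heq]; simp
    simp only [Finset.mem_insert, Finset.mem_singleton] at hi' hj'
    grind
  rw [hO] at ho
  simp only [Finset.mem_union, Finset.mem_image] at ho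
  rcases ho with (ho | ho) | ⟨i, -, rfl⟩
  · obtain ⟨i, j, hi, hj, h⟩ := hE o ho
    exact Or.inl ⟨i, j, hi, hj, h, ho, hdisj o ho⟩
  · obtain ⟨i, j, hij, h, h'⟩ := hEF o ho
    exact Or.inr (Or.inl ⟨i, j, hij, by tauto, h', fun h'' => hdisj o h'' ho, ho⟩)
  · refine Or.inr (Or.inr ⟨i, rfl, fun h => ?_, fun h => ?_⟩)
    · obtain ⟨j, k, hj, hk, h⟩ := hE _ h
      have h1 : j ∈ ({i} : Finset V) := by rw [h]; simp
      have h2 : k ∈ ({i} : Finset V) := by rw [h]; simp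
      rw [Finset.mem_singleton] at h1 h2
      exact hk (h2.trans h1.symm ▸ hj)
    · obtain ⟨j, k, hjk, -, h⟩ := hEF _ h
      have h1 : j ∈ ({i} : Finset V) := by rw [h]; simp
      have h2 : k ∈ ({i} : Finset V) := by rw [h]; simp
      rw [Finset.mem_singleton] at h1 h2
      exact hjk (h1.trans h2.symm)

theorem piDist_mul_le_splice {A : Finset V} (hT : ∀ o, 0 < T o)
    (hall : ∀ o ∈ O, IsAllowed A E EF o) (x y : Fin (2 * B) → {e : Finset V // e ∈ O}) (k : ℕ)
    (hk : k ≤ 2 * B) :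
    piDist E EF O B T x * piDist E EF O B T y ≤
      2 ^ (2 * A.card) * (piDist E EF O B T (splice k x y) * piDist E EF O B T (splice k y x)) := by
  have hL := numLoops_exchange (A := A) (E := E) (EF := EF)
    (x := fun t => (x t : Finset V)) (y := fun t => (y t : Finset V))
    (z := fun t => (splice k x y t).1) (z' := fun t => (splice k y x t).1)
    (fun t => hall _ (x t).2) (fun t => hall _ (y t).2) k hk
    (fun t => by simp only [splice]; split_ifs <;> rfl)
    (fun t => by simp only [splice]; split_ifs <;> rfl)
  have hprod : (∏ t, T (splice k x y t)) * ∏ t, T (splice k y x t) =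
      (∏ t, T (x t)) * ∏ t, T (y t) := by
    rw [← Finset.prod_mul_distrib, ← Finset.prod_mul_distrib]
    refine Finset.prod_congr rfl fun t _ => ?_
    simp only [splice]
    split_ifs
    · exact mul_comm _ _
    · rfl
  simp only [piDist]
  rw [div_mul_div_comm, div_mul_div_comm, ← mul_div_assoc]
  refine div_le_div_of_nonneg_right ?_
    (mul_pos (sum_confWt_pos hT x) (sum_confWt_pos hT x)).le
  simp only [confWt]
  rw [mul_mul_mul_comm, mul_mul_mul_comm (2 ^ _) (∏ t, T (splice k x y t)), hprod, ← mul_assoc (2 ^ (2 * A.card))]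
  refine mul_le_mul_of_nonneg_right ?_
    (mul_pos (Finset.prod_pos fun _ _ => hT _) (Finset.prod_pos fun _ _ => hT _)).le
  rw [← pow_add, ← pow_add, ← pow_add]
  exact pow_le_pow_right₀ one_le_two (by omega)

theorem piDist_update_le {A : Finset V} (hT : ∀ o, 0 < T o)
    (hall : ∀ o ∈ O, IsAllowed A E EF o) {R : ℝ} (hR : ∀ o q, T o ≤ R * T q)
    (x : Fin (2 * B) → {e : Finset V // e ∈ O}) (k : Fin (2 * B)) (o q : {e : Finset V // e ∈ O}) :
    piDist E EF O B T (Function.update x k o) ≤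
      16 * R * piDist E EF O B T (Function.update x k q) := by
  have hL := numLoops_le_of_eq_off (A := A) (E := E) (EF := EF)
    (x := fun t => (Function.update x k o t : Finset V))
    (y := fun t => (Function.update x k q t : Finset V))
    (fun t => hall _ (Function.update x k o t).2) (fun t => hall _ (Function.update x k q t).2) k
    (fun t ht => by simp only [Function.update_of_ne ht])
  have hsplit : ∀ o, ∏ t, T (Function.update x k o t) =
      T o * ∏ t ∈ Finset.univ.erase k, T (x t) := by
    intro o
    rw [← Finset.mul_prod_erase _ _ (Finset.mem_univ k), Function.update_self]
    congr 1
    refine Finset.prod_congr rfl fun t ht => ?_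
    rw [Function.update_of_ne (Finset.ne_of_mem_erase ht)]
  simp only [piDist]
  rw [← mul_div_assoc]
  refine div_le_div_of_nonneg_right ?_ (sum_confWt_pos hT x).le
  simp only [confWt]
  rw [hsplit, hsplit]
  have hW : 0 < ∏ t ∈ Finset.univ.erase k, T (x t) := Finset.prod_pos fun _ _ => hT _
  have h1 : (2 : ℝ) ^ numLoops E EF (2 * B) (fun t => (Function.update x k o t : Finset V)) ≤
      2 ^ numLoops E EF (2 * B) (fun t => (Function.update x k q t : Finset V)) * 16 := by
    refine (pow_le_pow_right₀ one_le_two hL).trans (le_of_eq ?_)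
    rw [pow_add]
    norm_num
  calc _ ≤ _ * 16 * (R * T q * ∏ t ∈ Finset.univ.erase k, T (x t)) :=
        mul_le_mul h1 (mul_le_mul_of_nonneg_right (hR o q) hW.le)
          (mul_pos (hT o) hW).le (by positivity)
    _ = _ := by ring

theorem inv_pow_le_piDist {A : Finset V} (hT : ∀ o, 0 < T o)
    (hall : ∀ o ∈ O, IsAllowed A E EF o) (hcard : 0 < O.card) {R : ℝ}
    (hR0 : 0 < R) (hR : ∀ o q, T o ≤ R * T q) (x : Fin (2 * B) → {e : Finset V // e ∈ O}) :
    (((4 * O.card * R) ^ B) ^ 2)⁻¹ ≤ piDist E EF O B T x := by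
  have hZ : ∀ y, confWt E EF O B T y ≤ (4 * R) ^ (2 * B) * confWt E EF O B T x := by
    intro y
    have hy := numLoops_le (A := A) (E := E) (EF := EF) (n := 2 * B)
      (x := fun t => (y t : Finset V)) (fun t => hall _ (y t).2)
    have hx := le_numLoops (A := A) (E := E) (EF := EF) (n := 2 * B)
      (x := fun t => (x t : Finset V)) (fun t => hall _ (x t).2)
    have h1 : (2 : ℝ) ^ numLoops E EF (2 * B) (fun t => (y t : Finset V)) ≤
        4 ^ (2 * B) * 2 ^ numLoops E EF (2 * B) (fun t => (x t : Finset V)) := by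
      rw [show (4 : ℝ) = 2 ^ 2 by norm_num, ← pow_mul, ← pow_add]
      exact pow_le_pow_right₀ one_le_two (by omega)
    have h2 : ∏ t, T (y t) ≤ R ^ (2 * B) * ∏ t, T (x t) := by
      calc ∏ t, T (y t) ≤ ∏ t, R * T (x t) :=
            Finset.prod_le_prod (fun t _ => (hT _).le) fun t _ => hR _ _
        _ = _ := by simp [Finset.prod_mul_distrib]
    calc confWt E EF O B T y ≤ _ * _ :=
          mul_le_mul h1 h2 (Finset.prod_pos fun t _ => hT _).le (by positivity)
      _ = _ := by rw [confWt, mul_pow]; ring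
  have hsum : ∑ y, confWt E EF O B T y ≤ (4 * O.card * R) ^ (2 * B) * confWt E EF O B T x := by
    refine (Finset.sum_le_sum fun y _ => hZ y).trans (le_of_eq ?_)
    rw [Finset.sum_const, nsmul_eq_mul, Finset.card_univ, Fintype.card_fun, Fintype.card_fin,
      Fintype.card_coe]
    push_cast
    simp only [mul_pow]
    ring
  have hm : 0 < (O.card : ℝ) := by exact_mod_cast hcard
  rw [← pow_mul, mul_comm B, piDist, inv_le_comm₀ (by positivity)
    (div_pos (confWt_pos hT x) (sum_confWt_pos hT x)), inv_div,
    div_le_iff₀ (confWt_pos hT x)]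
  exact hsum

end MixingTime

/-- Mixing-time bound for the SPE Metropolis chain: there is a number
of steps `t ≤ 24 B³ N (T_max/T_min) 2^{8|𝒜|−4} ln(8 T_min)` after which, from every
starting configuration, the distribution is within total-variation distance `1/4`
of the stationary distribution `π`. -/
theorem mixing_time_bound
    (A : Finset V) (E EF : Finset (Finset V)) (VX : Finset V)
    (hE : ∀ e ∈ E, ∃ i j : V, i ∈ A ∧ j ∉ A ∧ e = {i, j})
    (hEF : ∀ e ∈ EF, ∃ i j : V, i ≠ j ∧ ((i ∈ A ∧ j ∈ A) ∨ (i ∉ A ∧ j ∉ A)) ∧ e = {i, j})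
    (hA : 1 ≤ A.card) (hAB : A.card ≤ Aᶜ.card)
    (B : ℕ) (hB : 0 < B)
    (O : Finset (Finset V))
    (hO : O = E ∪ EF ∪ VX.image (fun i => ({i} : Finset V)))
    (hOcard : O.card ≤ 3 * Fintype.card V)
    (T : {e : Finset V // e ∈ O} → ℝ) (hT : ∀ o, 0 < T o)
    (Tmax Tmin : ℝ)
    (hTmax : (∀ o, T o ≤ Tmax) ∧ ∃ o, T o = Tmax)
    (hTmin : (∀ o, Tmin ≤ T o) ∧ ∃ o, T o = Tmin)
    (hTmin1 : 1 ≤ Tmin) :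
    ∃ t : ℕ,
      (t : ℝ) ≤ 24 * (B : ℝ) ^ 3 * (Fintype.card V) * (Tmax / Tmin) *
          2 ^ (8 * A.card - 4) * Real.log (8 * Tmin) ∧
      ∀ x : Fin (2 * B) → {e : Finset V // e ∈ O},
        (1 / 2) * ∑ y, |(transMat E EF O B T ^ t) x y - piDist E EF O B T y| ≤ 1 / 4 := by
  obtain ⟨o₀, ho₀⟩ := hTmin.2
  have hTmin0 : 0 < Tmin := by linarith
  have hall : ∀ o ∈ O, IsAllowed A E EF o := fun o ho => isAllowed_of_mem hE hEF hO ho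
  set R := Tmax / Tmin with hRdef
  have hR1 : 1 ≤ R := by
    rw [hRdef, one_le_div hTmin0]
    exact (hTmin.1 o₀).trans (hTmax.1 o₀)
  have hR : ∀ o q, T o ≤ R * T q := by
    intro o q
    calc T o ≤ Tmax := hTmax.1 o
      _ = R * Tmin := by rw [hRdef, div_mul_cancel₀ _ hTmin0.ne']
      _ ≤ R * T q := mul_le_mul_of_nonneg_left (hTmin.1 q) (by linarith)
  have hcard : 1 ≤ O.card := Finset.card_pos.2 ⟨o₀.1, o₀.2⟩
  have hB0 : (0 : ℝ) < B := by exact_mod_cast hB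
  have hm0 : (0 : ℝ) < O.card := by exact_mod_cast hcard
  obtain ⟨t, ht, hdecay⟩ := exists_steps_le hB hA hcard hOcard hR1 hTmin1
  refine ⟨t, ht, fun x => ?_⟩
  have hp := piDist_pos (E := E) (EF := EF) (B := B) hT
  have hsum := sum_piDist (E := E) (EF := EF) hT x
  have hB1 : (1 : ℝ) ≤ B := by exact_mod_cast hB
  have hq1 : 1 ≤ min (O.card : ℝ) (32 * R) :=
    le_min (by exact_mod_cast hcard) (by linarith)
  have hρ1 : 1 < 4 * (B : ℝ) ^ 2 * 2 ^ (2 * A.card) * min (O.card : ℝ) (32 * R) := by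
    have h1 : 1 ≤ (B : ℝ) ^ 2 * 2 ^ (2 * A.card) * min (O.card : ℝ) (32 * R) :=
      one_le_mul_of_one_le_of_one_le
        (one_le_mul_of_one_le_of_one_le (one_le_pow₀ hB1) (one_le_pow₀ one_le_two)) hq1
    linarith
  have key := metropolis_sum_abs_le hp hsum (P := transMat E EF O B T)
    (c := 1 / (2 * B * O.card)) (K := 2 ^ (2 * A.card))
    (M := min (O.card : ℝ) (32 * R) / O.card)
    (by positivity) (by rw [Fintype.card_coe]; push_cast; field_simp; rfl)
    (piDist_mul_transMat_comm hT) (piDist_mul_transMat_mulVec hT) (by positivity)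
    (piDist_mul_le_splice hT hall) ?_ (le_of_eq ?_) hρ1 t x
  · have h1 : 1 / √(piDist E EF O B T x) ≤ (4 * O.card * R) ^ B := by
      rw [one_div, inv_le_comm₀ (Real.sqrt_pos.2 (hp x)) (by positivity)]
      refine Real.le_sqrt_of_sq_le ?_
      rw [inv_pow]
      exact inv_pow_le_piDist hT hall hcard (by linarith) hR x
    have h2 := mul_le_mul_of_nonneg_left h1
      (pow_nonneg (sub_nonneg.2 (inv_lt_one_of_one_lt₀ hρ1).le) t)
    rw [← div_eq_mul_one_div] at h2
    linarith
  · intro k o q hoq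
    rw [le_div_iff₀ hm0, mul_comm]
    refine le_min ?_ ?_
    · have h1 := mul_le_mul_of_nonneg_left (sum_filter_add_le_one hp hsum k o q hoq) hm0.le
      rwa [mul_one] at h1
    · have h1 := card_mul_sum_filter_add_le hsum (piDist_update_le hT hall hR) k o q
      rw [Fintype.card_coe] at h1
      linarith
  · push_cast
    field_simp
    ring
end

section
/- Let H be a Hermitian d×d complex matrix all of whose off-diagonal entries are real and ≤ 0 (stoquastic), and let E₀ be its minimal eigenvalue. Then there exists a unit eigenvector ψ₀ of H with eigenvalue E₀ all of whose entries are real and ≥ 0; consequently, letting u ∈ ℂ^d be the unit vector with all entries equal to d^{−1/2}, one has |⟨u, ψ₀⟩|² ≥ 1/d. In particular, for H acting on (ℂ²)^{⊗N} (d = 2^N), the overlap of this ground state with the uniform state |+^N⟩ satisfies |⟨+^N, ψ₀⟩|² ≥ 2^{−N}. -/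
open Matrix

/-- The entrywise absolute value of a vector does not increase the quadratic form of a matrix with
real nonpositive off-diagonal entries. -/
lemma re_star_norm_dotProduct_mulVec_le {n : Type*} [Fintype n] (A : Matrix n n ℂ)
    (hA : ∀ i j, i ≠ j → (A i j).im = 0 ∧ (A i j).re ≤ 0) (v : n → ℂ) :
    (star (fun i => (‖v i‖ : ℂ)) ⬝ᵥ A *ᵥ (fun i => (‖v i‖ : ℂ))).re ≤
      (star v ⬝ᵥ A *ᵥ v).re := by
  simp only [dotProduct, mulVec, Finset.mul_sum, Complex.re_sum]
  refine Finset.sum_le_sum fun i _ => Finset.sum_le_sum fun j _ => ?_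
  have e : ∀ a b c : ℂ, star a * (b * c) = b * (star a * c) := fun a b c => by ring
  simp only [Pi.star_apply, e]
  by_cases hij : i = j
  · subst hij
    simp [← Complex.normSq_eq_conj_mul_self, Complex.normSq_eq_norm_sq, sq]
  · obtain ⟨him, hre⟩ := hA i j hij
    have h : (star (v i) * v j).re ≤ ‖v i‖ * ‖v j‖ := by
      simpa using Complex.re_le_norm (star (v i) * v j)
    rw [Complex.mul_re, Complex.mul_re, him]
    simpa [him] using mul_le_mul_of_nonpos_left h hre

open scoped ComplexOrder in
/-- Subtracting a lower bound of the eigenvalues from a Hermitian matrix leaves a positive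
semidefinite matrix. -/
lemma Matrix.IsHermitian.posSemidef_sub_smul_one {n : Type*} [Fintype n] [DecidableEq n]
    {A : Matrix n n ℂ} (hA : A.IsHermitian) {c : ℝ} (hc : ∀ i, c ≤ hA.eigenvalues i) :
    (A - (c : ℂ) • (1 : Matrix n n ℂ)).PosSemidef := by
  have hD : (diagonal fun i => ((hA.eigenvalues i - c : ℝ) : ℂ)).PosSemidef := by
    refine PosSemidef.diagonal fun i => ?_
    simpa using hc i
  have hU : (hA.eigenvectorUnitary : Matrix n n ℂ) * (hA.eigenvectorUnitary : Matrix n n ℂ)ᴴ = 1 :=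
    Unitary.coe_mul_star_self hA.eigenvectorUnitary
  convert hD.mul_mul_conjTranspose_same (hA.eigenvectorUnitary : Matrix n n ℂ) using 1
  have hsub : (diagonal fun i => ((hA.eigenvalues i - c : ℝ) : ℂ)) =
      diagonal (RCLike.ofReal ∘ hA.eigenvalues) - (c : ℂ) • (1 : Matrix n n ℂ) := by
    ext i j
    by_cases h : i = j <;> simp [h]
  rw [hsub, mul_sub, sub_mul, mul_smul_comm, smul_mul_assoc, mul_one, hU]
  congr 1
  conv_lhs => rw [hA.spectral_theorem]
  rfl

open scoped ComplexOrder in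
/-- The kernel of a positive semidefinite matrix with real nonpositive off-diagonal entries is
closed under entrywise absolute values. -/
lemma Matrix.PosSemidef.mulVec_norm_eq_zero {n : Type*} [Fintype n] {A : Matrix n n ℂ}
    (hpsd : A.PosSemidef) (hA : ∀ i j, i ≠ j → (A i j).im = 0 ∧ (A i j).re ≤ 0) {v : n → ℂ}
    (hv : A *ᵥ v = 0) : A *ᵥ (fun i => (‖v i‖ : ℂ)) = 0 := by
  rw [← hpsd.dotProduct_mulVec_zero_iff]
  have h0 := Complex.le_def.1 (hpsd.dotProduct_mulVec_nonneg fun i => (‖v i‖ : ℂ))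
  have h1 := re_star_norm_dotProduct_mulVec_le A hA v
  rw [hv, dotProduct_zero, Complex.zero_re] at h1
  exact Complex.ext (le_antisymm h1 h0.1) h0.2.symm

/-- A stoquastic Hermitian matrix has a ground state (unit eigenvector
for the minimal eigenvalue `E₀`) with all entries real and nonnegative, and consequently
its overlap with the uniform unit vector `u = d^{−1/2}(1,…,1)` satisfies
`|⟨u, ψ₀⟩|² ≥ 1/d`. -/
theorem stoquastic_ground_state_overlap {d : ℕ}
    (H : Matrix (Fin d) (Fin d) ℂ) (hH : H.IsHermitian)
    (hstoq : ∀ i j, i ≠ j → (H i j).im = 0 ∧ (H i j).re ≤ 0)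
    (E0 : ℝ) (hmin : ∀ i, E0 ≤ hH.eigenvalues i)
    (hex : ∃ i, hH.eigenvalues i = E0) :
    ∃ ψ₀ : Fin d → ℂ,
      star ψ₀ ⬝ᵥ ψ₀ = 1 ∧
      H *ᵥ ψ₀ = (E0 : ℂ) • ψ₀ ∧
      (∀ i, (ψ₀ i).im = 0 ∧ 0 ≤ (ψ₀ i).re) ∧
      1 / (d : ℝ) ≤
        Complex.normSq (star (fun _ : Fin d => (((Real.sqrt d)⁻¹ : ℝ) : ℂ)) ⬝ᵥ ψ₀) := by
  obtain ⟨k, hk⟩ := hex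
  have hpsd := hH.posSemidef_sub_smul_one hmin
  set M := H - (E0 : ℂ) • (1 : Matrix (Fin d) (Fin d) ℂ) with hM
  have hMstoq : ∀ i j, i ≠ j → (M i j).im = 0 ∧ (M i j).re ≤ 0 := fun i j hij => by
    simpa [hM, one_apply_ne hij] using hstoq i j hij
  have hMvec : ∀ x, M *ᵥ x = H *ᵥ x - (E0 : ℂ) • x := fun x => by
    rw [hM, sub_mulVec, smul_mulVec, one_mulVec]
  set v : Fin d → ℂ := ⇑(hH.eigenvectorBasis k) with hv
  have hMv : M *ᵥ v = 0 := by
    rw [hMvec, hv, hH.mulVec_eigenvectorBasis k, hk]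
    ext i
    simp
  have hnorm : ∑ i, ‖v i‖ ^ 2 = 1 := by
    rw [← EuclideanSpace.norm_sq_eq, hH.eigenvectorBasis.norm_eq_one, one_pow]
  set w : Fin d → ℂ := fun i => (‖v i‖ : ℂ) with hw
  have hMw : M *ᵥ w = 0 := hpsd.mulVec_norm_eq_zero hMstoq hMv
  refine ⟨w, ?_, sub_eq_zero.1 (hMvec w ▸ hMw), fun i => by simp [hw], ?_⟩
  · have h : star w ⬝ᵥ w = ((∑ i, ‖v i‖ ^ 2 : ℝ) : ℂ) := by
      simp [hw, dotProduct, sq]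
    rw [h, hnorm, Complex.ofReal_one]
  · have h : star (fun _ : Fin d => (((Real.sqrt d)⁻¹ : ℝ) : ℂ)) ⬝ᵥ w =
        (((Real.sqrt d)⁻¹ * ∑ i, ‖v i‖ : ℝ) : ℂ) := by
      simp [hw, dotProduct, Finset.mul_sum]
    rw [h, Complex.normSq_ofReal, ← sq, mul_pow, inv_pow, Real.sq_sqrt d.cast_nonneg, one_div]
    refine le_mul_of_one_le_right (by positivity) ?_
    rw [← hnorm]
    exact Finset.sum_sq_le_sq_sum_of_nonneg fun i _ => norm_nonneg (v i)
end

section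
/- (Lieb–Mattis) Let 𝒢 = (𝒱, ℰ) be a connected bipartite graph on N vertices with parts 𝒜 and ℬ, let w : ℰ → ℝ_{>0}, and let H = −Σ_{(i,j)∈ℰ} w_{ij} h_{ij} act on (ℂ²)^{⊗N}, where h_{ij} = (𝟙 − X_iX_j − Y_iY_j − Z_iZ_j)/4. Let Ŝ² = (Σ_{i=1}^N X_i)² + (Σ_{i=1}^N Y_i)² + (Σ_{i=1}^N Z_i)². Then every ground state (eigenvector of H with minimal eigenvalue) is an eigenvector of Ŝ² with eigenvalue 4S(S+1), where S = | |𝒜| − |ℬ| |/2, and the ground eigenspace of H has dimension exactly | |𝒜| − |ℬ| | + 1. -/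
open Matrix

/-- Pauli `X`. -/
def pauliX : Matrix (Fin 2) (Fin 2) ℂ := !![0, 1; 1, 0]

/-- Pauli `Y`. -/
def pauliY : Matrix (Fin 2) (Fin 2) ℂ := !![0, -Complex.I; Complex.I, 0]

/-- Pauli `Z`. -/
def pauliZ : Matrix (Fin 2) (Fin 2) ℂ := !![1, 0; 0, -1]

/-- A 1-local operator `O_i` acting on the `i`-th tensor factor of `(ℂ²)^{⊗N}`, in the
computational (tensor product) basis indexed by strings `Fin N → Fin 2`. -/
def localOp {N : ℕ} (O : Matrix (Fin 2) (Fin 2) ℂ) (i : Fin N) :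
    Matrix (Fin N → Fin 2) (Fin N → Fin 2) ℂ :=
  Matrix.of fun σ τ =>
    O (σ i) (τ i) * ∏ j ∈ Finset.univ.erase i, (if σ j = τ j then (1 : ℂ) else 0)

/-- The Heisenberg interaction `h_{ij} = (𝟙 − X_iX_j − Y_iY_j − Z_iZ_j)/4`. -/
noncomputable def heisTerm {N : ℕ} (i j : Fin N) :
    Matrix (Fin N → Fin 2) (Fin N → Fin 2) ℂ :=
  (1 / 4 : ℂ) • ((1 : Matrix (Fin N → Fin 2) (Fin N → Fin 2) ℂ)
    - localOp pauliX i * localOp pauliX j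
    - localOp pauliY i * localOp pauliY j
    - localOp pauliZ i * localOp pauliZ j)

/-- The total-spin operator `Ŝ² = (Σ X_i)² + (Σ Y_i)² + (Σ Z_i)²`. -/
noncomputable def totalSpinSq (N : ℕ) : Matrix (Fin N → Fin 2) (Fin N → Fin 2) ℂ :=
  (∑ i, localOp pauliX i) * (∑ i, localOp pauliX i) +
  (∑ i, localOp pauliY i) * (∑ i, localOp pauliY i) +
  (∑ i, localOp pauliZ i) * (∑ i, localOp pauliZ i)

section LocalOperators

variable {N : ℕ}

lemma localOp_mulVec (O : Matrix (Fin 2) (Fin 2) ℂ) (i : Fin N) (ψ : (Fin N → Fin 2) → ℂ)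
    (σ : Fin N → Fin 2) :
    (localOp O i *ᵥ ψ) σ = ∑ s, O (σ i) s * ψ (Function.update σ i s) := by
  classical
  have hinj : Function.Injective (fun s : Fin 2 => Function.update σ i s) :=
    Function.update_injective σ i
  rw [← Finset.sum_image (g := fun s : Fin 2 => Function.update σ i s)
    (f := fun τ => O (σ i) (τ i) * ψ τ) (s := Finset.univ) (by simpa using hinj) |>.trans
      (Finset.sum_congr rfl fun s _ => by simp)]
  rw [Matrix.mulVec, dotProduct]
  symm
  refine (Finset.sum_congr rfl ?_).trans (Finset.sum_subset (Finset.subset_univ _) ?_)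
  · intro τ hτ
    obtain ⟨s, -, rfl⟩ := Finset.mem_image.1 hτ
    have : ∏ j ∈ Finset.univ.erase i,
        (if σ j = Function.update σ i s j then (1 : ℂ) else 0) = 1 :=
      Finset.prod_eq_one fun j hj => by simp [Finset.ne_of_mem_erase hj]
    simp only [localOp, Matrix.of_apply, this, mul_one]
  · intro τ _ hτ
    have : ∃ j ∈ Finset.univ.erase i, σ j ≠ τ j := by
      by_contra! h
      refine hτ (Finset.mem_image.2 ⟨τ i, Finset.mem_univ _, ?_⟩)
      ext j
      by_cases hj : j = i
      · subst hj; simp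
      · simp [hj, h j (by simp [hj])]
    obtain ⟨j, hj, hne⟩ := this
    have : ∏ j ∈ Finset.univ.erase i, (if σ j = τ j then (1 : ℂ) else 0) = 0 :=
      Finset.prod_eq_zero hj (if_neg hne)
    simp only [localOp, Matrix.of_apply, this, mul_zero, zero_mul]

lemma localOp_mul_localOp_self (O Q : Matrix (Fin 2) (Fin 2) ℂ) (i : Fin N) :
    localOp O i * localOp Q i = localOp (O * Q) i := by
  refine Matrix.ext_of_mulVec_single fun τ => ?_
  funext σ
  simp only [← Matrix.mulVec_mulVec, localOp_mulVec, Matrix.mul_apply, Function.update_self,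
    Function.update_idem, Fin.sum_univ_two]
  ring

lemma localOp_commute (O Q : Matrix (Fin 2) (Fin 2) ℂ) {i j : Fin N} (h : i ≠ j) :
    localOp O i * localOp Q j = localOp Q j * localOp O i := by
  refine Matrix.ext_of_mulVec_single fun τ => ?_
  funext σ
  simp only [← Matrix.mulVec_mulVec, localOp_mulVec, Fin.sum_univ_two,
    Function.update_of_ne h, Function.update_of_ne h.symm, Function.update_comm h]
  ring

lemma localOp_sub (O Q : Matrix (Fin 2) (Fin 2) ℂ) (i : Fin N) :
    localOp (O - Q) i = localOp O i - localOp Q i := by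
  ext σ τ
  simp [localOp, sub_mul]

lemma localOp_add (O Q : Matrix (Fin 2) (Fin 2) ℂ) (i : Fin N) :
    localOp (O + Q) i = localOp O i + localOp Q i := by
  ext σ τ
  simp [localOp, add_mul]

lemma localOp_smul (c : ℂ) (O : Matrix (Fin 2) (Fin 2) ℂ) (i : Fin N) :
    localOp (c • O) i = c • localOp O i := by
  ext σ τ
  simp [localOp, mul_assoc]

/-- The operator `|0⟩⟨1|` on one site. -/
def siteLower : Matrix (Fin 2) (Fin 2) ℂ := !![0, 1; 0, 0]

/-- The operator `|1⟩⟨0|` on one site. -/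
def siteRaise : Matrix (Fin 2) (Fin 2) ℂ := !![0, 0; 1, 0]

/-- The ladder operator decreasing the number of ones. -/
noncomputable def ladderL (N : ℕ) : Matrix (Fin N → Fin 2) (Fin N → Fin 2) ℂ :=
  ∑ i, localOp siteLower i

/-- The ladder operator increasing the number of ones. -/
noncomputable def ladderR (N : ℕ) : Matrix (Fin N → Fin 2) (Fin N → Fin 2) ℂ :=
  ∑ i, localOp siteRaise i

lemma ladder_commutator (N : ℕ) :
    ladderL N * ladderR N - ladderR N * ladderL N = ∑ i, localOp pauliZ i := by
  have hZ : pauliZ = siteLower * siteRaise - siteRaise * siteLower := by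
    ext i j
    fin_cases i <;> fin_cases j <;> simp [pauliZ, siteLower, siteRaise]
  simp only [ladderL, ladderR, Finset.sum_mul_sum]
  rw [Finset.sum_comm (f := fun i j => localOp siteRaise i * localOp siteLower j),
    ← Finset.sum_sub_distrib]
  refine Finset.sum_congr rfl fun i _ => ?_
  rw [← Finset.sum_sub_distrib, Finset.sum_eq_single i]
  · rw [localOp_mul_localOp_self, localOp_mul_localOp_self, hZ, localOp_sub]
  · intro j _ hj
    rw [localOp_commute _ _ hj, sub_self]
  · simp

lemma totalSpinSq_eq (N : ℕ) :
    totalSpinSq N = (2 : ℂ) • (ladderL N * ladderR N + ladderR N * ladderL N) +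
      (∑ i, localOp pauliZ i) * (∑ i, localOp pauliZ i) := by
  have hX : pauliX = siteLower + siteRaise := by
    ext i j
    fin_cases i <;> fin_cases j <;> simp [pauliX, siteLower, siteRaise]
  have hY : pauliY = Complex.I • (siteRaise - siteLower) := by
    ext i j
    fin_cases i <;> fin_cases j <;> simp [pauliY, siteLower, siteRaise]
  have hX' : ∑ i, localOp (N := N) pauliX i = ladderL N + ladderR N := by
    simp [hX, localOp_add, Finset.sum_add_distrib, ladderL, ladderR]
  have hY' : ∑ i, localOp (N := N) pauliY i = Complex.I • (ladderR N - ladderL N) := by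
    simp [hY, localOp_sub, localOp_smul, ladderL, ladderR, ← Finset.smul_sum]
  rw [totalSpinSq, hX', hY', smul_mul_smul_comm, Complex.I_mul_I, two_smul, neg_one_smul]
  noncomm_ring

lemma localOp_transpose (O : Matrix (Fin 2) (Fin 2) ℂ) (i : Fin N) :
    (localOp O i)ᵀ = localOp Oᵀ i := by
  ext σ τ
  simp only [localOp, Matrix.transpose_apply, Matrix.of_apply, eq_comm]

lemma localOp_conjTranspose (O : Matrix (Fin 2) (Fin 2) ℂ) (i : Fin N) :
    (localOp O i)ᴴ = localOp Oᴴ i := by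
  ext σ τ
  simp only [localOp, Matrix.conjTranspose_apply, Matrix.of_apply, star_mul', star_prod]
  congr 1
  refine Finset.prod_congr rfl fun j _ => ?_
  simp only [eq_comm (a := τ j)]
  split_ifs <;> simp

lemma ladderL_transpose (N : ℕ) : (ladderL N)ᵀ = ladderR N := by
  have h : siteLowerᵀ = siteRaise := by
    ext i j
    fin_cases i <;> fin_cases j <;> simp [siteLower, siteRaise]
  simp [ladderL, ladderR, Matrix.transpose_sum, localOp_transpose, h]

lemma ladderL_conjTranspose (N : ℕ) : (ladderL N)ᴴ = ladderR N := by
  have h : siteLowerᴴ = siteRaise := by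
    ext i j
    fin_cases i <;> fin_cases j <;> simp [siteLower, siteRaise]
  simp [ladderL, ladderR, Matrix.conjTranspose_sum, localOp_conjTranspose, h]

lemma ladderR_conjTranspose (N : ℕ) : (ladderR N)ᴴ = ladderL N := by
  rw [← ladderL_conjTranspose, Matrix.conjTranspose_conjTranspose]

lemma sum_localOp_mulVec_comp (O : Matrix (Fin 2) (Fin 2) ℂ) (ψ : (Fin N → Fin 2) → ℂ)
    (π : Equiv.Perm (Fin N)) :
    (∑ i, localOp O i) *ᵥ (fun σ => ψ (σ ∘ π)) =
      fun σ => ((∑ i, localOp O i) *ᵥ ψ) (σ ∘ π) := by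
  funext σ
  simp only [Matrix.sum_mulVec, Finset.sum_apply, localOp_mulVec]
  rw [← Equiv.sum_comp π (fun i => ∑ s, O (σ i) s * ψ (Function.update σ i s ∘ π))]
  refine Finset.sum_congr rfl fun i _ => Finset.sum_congr rfl fun s _ => ?_
  rw [Function.update_comp_equiv, Equiv.symm_apply_apply, Function.comp_apply]

lemma ladderL_mulVec (ψ : (Fin N → Fin 2) → ℂ) (σ : Fin N → Fin 2) :
    (ladderL N *ᵥ ψ) σ = ∑ i, if σ i = 0 then ψ (Function.update σ i 1) else 0 := by
  rw [ladderL, Matrix.sum_mulVec, Finset.sum_apply]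
  refine Finset.sum_congr rfl fun i _ => ?_
  rw [localOp_mulVec]
  generalize σ i = s
  fin_cases s <;> simp [siteLower]

lemma ladderR_mulVec (ψ : (Fin N → Fin 2) → ℂ) (σ : Fin N → Fin 2) :
    (ladderR N *ᵥ ψ) σ = ∑ i, if σ i = 1 then ψ (Function.update σ i 0) else 0 := by
  rw [ladderR, Matrix.sum_mulVec, Finset.sum_apply]
  refine Finset.sum_congr rfl fun i _ => ?_
  rw [localOp_mulVec]
  generalize σ i = s
  fin_cases s <;> simp [siteRaise]

lemma heisTerm_mulVec {i j : Fin N} (h : i ≠ j) (ψ : (Fin N → Fin 2) → ℂ)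
    (σ : Fin N → Fin 2) :
    (heisTerm i j *ᵥ ψ) σ = 1 / 2 * (ψ σ - ψ (σ ∘ Equiv.swap i j)) := by
  have hi : Function.update σ i (σ i) = σ := Function.update_eq_self i σ
  have hj₀ : Function.update σ j (σ j) = σ := Function.update_eq_self j σ
  have hj : ∀ s, Function.update (Function.update σ i s) j (σ j) = Function.update σ i s :=
    fun s => Function.update_eq_self_iff.2 (by simp [h.symm])
  rw [Equiv.comp_swap_eq_update, show Function.update (Function.update σ j (σ i)) i (σ j) =
    Function.update (Function.update σ i (σ j)) j (σ i) from Function.update_comm h.symm _ _ _]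
  simp only [heisTerm, Matrix.smul_mulVec, Matrix.sub_mulVec, Matrix.one_mulVec, Pi.smul_apply,
    Pi.sub_apply, ← Matrix.mulVec_mulVec, localOp_mulVec, Fin.sum_univ_two,
    Function.update_of_ne h.symm, smul_eq_mul]
  generalize σ i = s at *
  generalize σ j = t at *
  have h2 : ∀ s : Fin 2, s = 0 ∨ s = 1 := by decide
  rcases h2 s with rfl | rfl <;> rcases h2 t with rfl | rfl <;>
    simp [pauliX, pauliY, pauliZ, hi, hj, hj₀] <;> ring_nf <;> rw [Complex.I_sq] <;> ring

lemma heisTerm_mul_sum_localOp {i j : Fin N} (h : i ≠ j) (O : Matrix (Fin 2) (Fin 2) ℂ) :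
    heisTerm i j * (∑ l, localOp O l) = (∑ l, localOp O l) * heisTerm i j := by
  have key : ∀ ψ : (Fin N → Fin 2) → ℂ, heisTerm i j *ᵥ ψ =
      (1 / 2 : ℂ) • (ψ - fun σ => ψ (σ ∘ Equiv.swap i j)) := fun ψ =>
    funext fun σ => heisTerm_mulVec h ψ σ
  refine Matrix.ext_of_mulVec_single fun τ => ?_
  rw [← Matrix.mulVec_mulVec, ← Matrix.mulVec_mulVec, key, key, Matrix.mulVec_smul,
    Matrix.mulVec_sub, sum_localOp_mulVec_comp]

lemma heisTerm_isHermitian {i j : Fin N} (h : i ≠ j) : (heisTerm i j).IsHermitian := by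
  have hX : pauliXᴴ = pauliX := by
    ext i j
    fin_cases i <;> fin_cases j <;> simp [pauliX]
  have hY : pauliYᴴ = pauliY := by
    ext i j
    fin_cases i <;> fin_cases j <;> simp [pauliY]
  have hZ : pauliZᴴ = pauliZ := by
    ext i j
    fin_cases i <;> fin_cases j <;> simp [pauliZ]
  simp [Matrix.IsHermitian, heisTerm, Matrix.conjTranspose_sub, Matrix.conjTranspose_mul,
    localOp_conjTranspose, hX, hY, hZ, localOp_commute _ _ h]

end LocalOperators

section Configurations

variable {N : ℕ}

/-- The number of sites in `A` carrying the letter `s`. -/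
def siteCount (s : Fin 2) (A : Finset (Fin N)) (σ : Fin N → Fin 2) : ℕ :=
  (A.filter fun i => σ i = s).card

lemma siteCount_update_ne {s : Fin 2} (A : Finset (Fin N)) {σ : Fin N → Fin 2} {i : Fin N}
    (h : σ i ≠ s) :
    siteCount s A (Function.update σ i s) = siteCount s A σ + if i ∈ A then 1 else 0 := by
  classical
  split_ifs with hi
  · rw [siteCount, siteCount, ← Finset.card_insert_of_notMem (a := i) (by simp [h])]
    congr 1
    ext j
    by_cases hj : j = i
    · subst hj; simp [hi]
    · simp [hj]
  · rw [siteCount, siteCount, add_zero]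
    congr 1
    ext j
    by_cases hj : j = i
    · subst hj; simp [hi]
    · simp [hj]

lemma siteCount_update_eq {s t : Fin 2} (A : Finset (Fin N)) {σ : Fin N → Fin 2} {i : Fin N}
    (h : σ i = s) (hts : t ≠ s) :
    siteCount s A (Function.update σ i t) + (if i ∈ A then 1 else 0) = siteCount s A σ := by
  rw [← siteCount_update_ne A (σ := Function.update σ i t) (by simpa using hts)]
  simp [← h]

lemma siteCount_zero_add_one (A : Finset (Fin N)) (σ : Fin N → Fin 2) :
    siteCount 0 A σ + siteCount 1 A σ = A.card := by
  rw [siteCount, siteCount, ← Finset.card_filter_add_card_filter_not (s := A) (fun i => σ i = 0)]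
  congr 3
  ext i
  generalize σ i = s
  fin_cases s <;> simp

lemma siteCount_univ (s : Fin 2) (A : Finset (Fin N)) (σ : Fin N → Fin 2) :
    siteCount s Finset.univ σ = siteCount s A σ + siteCount s Aᶜ σ := by
  simp only [siteCount, Finset.card_filter]
  exact (Finset.sum_add_sum_compl A _).symm

lemma siteCount_univ_comp (s : Fin 2) (σ : Fin N → Fin 2) (π : Equiv.Perm (Fin N)) :
    siteCount s Finset.univ (σ ∘ π) = siteCount s Finset.univ σ := by
  simp only [siteCount, Finset.card_filter]
  exact Equiv.sum_comp π (fun i => if σ i = s then 1 else 0)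

lemma comp_swap_eq_self {σ : Fin N → Fin 2} {i j : Fin N} (h : σ i = σ j) :
    σ ∘ Equiv.swap i j = σ := by
  rw [Equiv.comp_swap_eq_update, h, Function.update_eq_self, ← h, Function.update_eq_self]

lemma exists_perm_of_siteCount_eq {σ τ : Fin N → Fin 2}
    (h : siteCount 1 Finset.univ σ = siteCount 1 Finset.univ τ) :
    ∃ π : Equiv.Perm (Fin N), τ = σ ∘ π := by
  have hc : Fintype.card {i // τ i = 1} = Fintype.card {i // σ i = 1} := by
    simpa [siteCount, Fintype.card_subtype] using h.symm
  let e := Fintype.equivOfCardEq hc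
  refine ⟨e.extendSubtype, funext fun i => ?_⟩
  have h2 : ∀ s : Fin 2, s ≠ 1 → s = 0 := by decide
  by_cases hi : τ i = 1
  · simpa [hi] using (e.extendSubtype_mem i hi).symm
  · rw [Function.comp_apply, h2 _ hi, h2 _ (e.extendSubtype_not_mem i hi)]

/-- The sign of the sublattice rotation on `A`. -/
noncomputable def marshallSign (A : Finset (Fin N)) (σ : Fin N → Fin 2) : ℝ :=
  (-1) ^ siteCount 1 A σ

lemma marshallSign_mul_self (A : Finset (Fin N)) (σ : Fin N → Fin 2) :
    marshallSign A σ * marshallSign A σ = 1 := by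
  rw [marshallSign, ← mul_pow]; simp

lemma marshallSign_swap (A : Finset (Fin N)) {i j : Fin N} (hij : i ∈ A ↔ j ∉ A)
    {σ : Fin N → Fin 2} (h : σ i ≠ σ j) :
    marshallSign A (σ ∘ Equiv.swap i j) = -marshallSign A σ := by
  have key : ∀ {i j : Fin N}, i ∈ A → j ∉ A → σ i ≠ σ j →
      marshallSign A (σ ∘ Equiv.swap i j) = -marshallSign A σ := by
    intro i j hi hj h
    have hne : i ≠ j := fun h => hj (h ▸ hi)
    rw [Equiv.comp_swap_eq_update, marshallSign, marshallSign]
    have h2 : ∀ s : Fin 2, s = 0 ∨ s = 1 := by decide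
    have hj' : siteCount 1 A (Function.update σ j (σ i)) = siteCount 1 A σ := by
      rcases h2 (σ i) with hs | hs
      · have := siteCount_update_eq (s := 1) (t := 0) A (σ := σ) (i := j)
          (by rcases h2 (σ j) with h' | h' <;> simp_all) (by decide)
        simpa [hj, hs] using this
      · have := siteCount_update_ne (s := 1) A (σ := σ) (i := j)
          (by rcases h2 (σ j) with h' | h' <;> simp_all)
        simpa [hj, hs] using this
    rcases h2 (σ j) with hs | hs
    · have := siteCount_update_eq (s := 1) (t := 0) A
        (σ := Function.update σ j (σ i)) (i := i)
          (by rcases h2 (σ i) with h' | h' <;> simp_all) (by decide)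
      rw [hj'] at this
      rw [← this, hs]
      simp [hi, pow_succ]
    · have := siteCount_update_ne (s := 1) A
        (σ := Function.update σ j (σ i)) (i := i)
          (by rcases h2 (σ i) with h' | h' <;> simp_all)
      rw [hs, this, hj']
      simp [hi, pow_succ]
  by_cases hi : i ∈ A
  · exact key hi (hij.1 hi) h
  · rw [Equiv.swap_comm]
    exact key (by by_contra hj; exact hi (hij.2 hj)) hi h.symm

/-- A reference vector, with the Marshall signs, spanning the multiplet in which the two
sublattice spins are maximal and antiparallel. -/
noncomputable def refState (A : Finset (Fin N)) (σ : Fin N → Fin 2) : ℂ :=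
  (-1) ^ siteCount 1 A σ * (siteCount 1 Aᶜ σ).factorial * (siteCount 0 Aᶜ σ).factorial

lemma sum_ite_siteCount (s : Fin 2) (A : Finset (Fin N)) (σ : Fin N → Fin 2) (x y : ℂ) :
    (∑ i, if σ i = s then (if i ∈ A then x else y) else 0) =
      siteCount s A σ * x + siteCount s Aᶜ σ * y := by
  rw [← Finset.sum_add_sum_compl A]
  congr 1
  · rw [siteCount, ← nsmul_eq_mul, ← Finset.sum_const, Finset.sum_filter]
    exact Finset.sum_congr rfl fun i hi => by simp [hi]
  · rw [siteCount, ← nsmul_eq_mul, ← Finset.sum_const, Finset.sum_filter]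
    exact Finset.sum_congr rfl fun i hi => by simp [Finset.mem_compl.1 hi]

lemma ladderL_refState (A : Finset (Fin N)) {σ : Fin N → Fin 2}
    (h : siteCount 1 Finset.univ σ < Aᶜ.card) :
    (ladderL N *ᵥ refState A) σ =
      (siteCount 1 Finset.univ σ + 1 - A.card) * refState A σ := by
  have hB := siteCount_zero_add_one Aᶜ σ
  have hA := siteCount_zero_add_one A σ
  have hu := siteCount_univ 1 A σ
  obtain ⟨n, hn⟩ : ∃ n, siteCount 0 Aᶜ σ = n + 1 := ⟨siteCount 0 Aᶜ σ - 1, by omega⟩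
  rw [ladderL_mulVec, Finset.sum_congr rfl (g := fun i => if σ i = 0 then (if i ∈ A then
    -refState A σ else (-1) ^ siteCount 1 A σ * (siteCount 1 Aᶜ σ + 1).factorial *
      n.factorial) else 0)]
  · rw [sum_ite_siteCount, refState, hn, hu, ← hA, Nat.factorial_succ, Nat.factorial_succ]
    push_cast
    ring
  · intro i _
    split_ifs with h0 hi
    · have h1 := siteCount_update_ne (s := 1) A (σ := σ) (i := i) (by simp [h0])
      have h2 := siteCount_update_ne (s := 1) Aᶜ (σ := σ) (i := i) (by simp [h0])
      have h3 := siteCount_update_eq (t := 1) Aᶜ h0 (by decide)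
      simp only [hi, Finset.mem_compl, not_true, if_true, if_false, add_zero] at h1 h2 h3
      rw [refState, h1, h2, h3, refState, pow_succ]
      ring
    · have h1 := siteCount_update_ne (s := 1) A (σ := σ) (i := i) (by simp [h0])
      have h2 := siteCount_update_ne (s := 1) Aᶜ (σ := σ) (i := i) (by simp [h0])
      have h3 := siteCount_update_eq (t := 1) Aᶜ h0 (by decide)
      simp only [hi, Finset.mem_compl, not_false_eq_true, if_true, if_false, add_zero] at h1 h2 h3
      have h4 : siteCount 0 Aᶜ (Function.update σ i 1) = n := by omega
      rw [refState, h1, h2, h4]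
    · rfl

lemma ladderR_refState (A : Finset (Fin N)) {σ : Fin N → Fin 2}
    (h : A.card < siteCount 1 Finset.univ σ) :
    (ladderR N *ᵥ refState A) σ =
      (Aᶜ.card + 1 - siteCount 1 Finset.univ σ) * refState A σ := by
  have hB := siteCount_zero_add_one Aᶜ σ
  have hA := siteCount_zero_add_one A σ
  have hu := siteCount_univ 1 A σ
  obtain ⟨n, hn⟩ : ∃ n, siteCount 1 Aᶜ σ = n + 1 := ⟨siteCount 1 Aᶜ σ - 1, by omega⟩
  rw [ladderR_mulVec, Finset.sum_congr rfl (g := fun i => if σ i = 1 then (if i ∈ A then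
    -refState A σ else (-1) ^ siteCount 1 A σ * n.factorial *
      (siteCount 0 Aᶜ σ + 1).factorial) else 0)]
  · rw [sum_ite_siteCount, refState, hu, ← hB, hn, Nat.factorial_succ, Nat.factorial_succ]
    push_cast
    ring
  · intro i _
    split_ifs with h0 hi
    · have h1 := siteCount_update_eq (t := 0) A h0 (by decide)
      have h2 := siteCount_update_eq (t := 0) Aᶜ h0 (by decide)
      have h3 := siteCount_update_ne (s := 0) Aᶜ (σ := σ) (i := i) (by simp [h0])
      simp only [hi, Finset.mem_compl, not_true, if_true, if_false, add_zero] at h1 h2 h3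
      rw [refState, h2, h3, refState, ← h1, pow_succ]
      ring
    · have h1 := siteCount_update_eq (t := 0) A h0 (by decide)
      have h2 := siteCount_update_eq (t := 0) Aᶜ h0 (by decide)
      have h3 := siteCount_update_ne (s := 0) Aᶜ (σ := σ) (i := i) (by simp [h0])
      simp only [hi, Finset.mem_compl, not_false_eq_true, if_true, if_false, add_zero] at h1 h2 h3
      have h4 : siteCount 1 Aᶜ (Function.update σ i 0) = n := by omega
      rw [refState, h1, h3, h4]
    · rfl

lemma refState_eq_marshallSign (A : Finset (Fin N)) (σ : Fin N → Fin 2) :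
    ∃ c : ℝ, 0 < c ∧ refState A σ = (marshallSign A σ * c : ℝ) :=
  ⟨(siteCount 1 Aᶜ σ).factorial * (siteCount 0 Aᶜ σ).factorial, by positivity, by
    simp [refState, marshallSign, mul_assoc]⟩

end Configurations

section Sectors

open scoped ComplexOrder

variable {N : ℕ}

/-- The state `ψ` is supported on configurations with exactly `k` ones. -/
def InSector (k : ℤ) (ψ : (Fin N → Fin 2) → ℂ) : Prop :=
  ∀ σ, ψ σ ≠ 0 → (siteCount 1 Finset.univ σ : ℤ) = k

lemma InSector.lower {k : ℤ} {ψ : (Fin N → Fin 2) → ℂ} (h : InSector k ψ) :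
    InSector (k - 1) (ladderL N *ᵥ ψ) := by
  intro σ hσ
  rw [ladderL_mulVec] at hσ
  obtain ⟨i, -, hi⟩ := Finset.exists_ne_zero_of_sum_ne_zero hσ
  split_ifs at hi with h0
  · have := siteCount_update_ne (s := 1) Finset.univ (σ := σ) (i := i) (by simp [h0])
    rw [← h _ hi, this]
    simp
  · exact absurd rfl hi

lemma InSector.raise {k : ℤ} {ψ : (Fin N → Fin 2) → ℂ} (h : InSector k ψ) :
    InSector (k + 1) (ladderR N *ᵥ ψ) := by
  intro σ hσ
  rw [ladderR_mulVec] at hσ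
  obtain ⟨i, -, hi⟩ := Finset.exists_ne_zero_of_sum_ne_zero hσ
  split_ifs at hi with h0
  · have := siteCount_update_eq (t := 0) Finset.univ h0 (by decide)
    rw [← h _ hi, ← this]
    simp
  · exact absurd rfl hi

lemma InSector.sum_pauliZ {k : ℤ} {ψ : (Fin N → Fin 2) → ℂ} (h : InSector k ψ) :
    (∑ i, localOp pauliZ i) *ᵥ ψ = ((N : ℂ) - 2 * k) • ψ := by
  funext σ
  have h2 : ∀ s : Fin 2, s = 0 ∨ s = 1 := by decide
  have hZ : ∀ i, (localOp pauliZ i *ᵥ ψ) σ = (1 - 2 * if σ i = 1 then 1 else 0) * ψ σ := by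
    intro i
    rw [localOp_mulVec, Fin.sum_univ_two]
    have hi := Function.update_eq_self i σ
    rcases h2 (σ i) with hs | hs <;> rw [hs] at hi ⊢ <;> simp [pauliZ, hi]
    ring
  simp only [Matrix.sum_mulVec, Finset.sum_apply, hZ, ← Finset.sum_mul,
    Finset.sum_sub_distrib, ← Finset.mul_sum, Pi.smul_apply, smul_eq_mul]
  by_cases hσ : ψ σ = 0
  · simp [hσ]
  · rw [← h σ hσ, siteCount, Finset.card_filter]
    simp

/-- The component of `ψ` on configurations with `k` ones. -/
noncomputable def sectorPart (k : ℤ) (ψ : (Fin N → Fin 2) → ℂ) : (Fin N → Fin 2) → ℂ :=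
  fun σ => if (siteCount 1 Finset.univ σ : ℤ) = k then ψ σ else 0

lemma inSector_sectorPart (k : ℤ) (ψ : (Fin N → Fin 2) → ℂ) : InSector k (sectorPart k ψ) := by
  intro σ hσ
  by_contra h
  exact hσ (if_neg h)

lemma sum_sectorPart (ψ : (Fin N → Fin 2) → ℂ) :
    ∑ k ∈ Finset.range (N + 1), sectorPart (k : ℤ) ψ = ψ := by
  funext σ
  have hN := siteCount_zero_add_one Finset.univ σ
  rw [Finset.card_univ, Fintype.card_fin] at hN
  rw [Finset.sum_apply, Finset.sum_eq_single (siteCount 1 Finset.univ σ)]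
  · simp [sectorPart]
  · intro k _ hk
    simp [sectorPart, hk.symm]
  · intro h
    exact absurd (Finset.mem_range.2 (by omega)) h

lemma InSector.dotProduct_congr {k : ℤ} {ψ : (Fin N → Fin 2) → ℂ} (h : InSector k ψ)
    {f g : (Fin N → Fin 2) → ℂ}
    (hfg : ∀ σ, (siteCount 1 Finset.univ σ : ℤ) = k → f σ = g σ) : f ⬝ᵥ ψ = g ⬝ᵥ ψ := by
  refine Finset.sum_congr rfl fun σ _ => ?_
  by_cases hσ : ψ σ = 0
  · simp [hσ]
  · rw [hfg σ (h σ hσ)]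

lemma refState_dotProduct_ladder (A : Finset (Fin N)) {k : ℤ} (hA : A.card ≤ k)
    (hB : k ≤ Aᶜ.card) {ψ : (Fin N → Fin 2) → ℂ} (h : InSector k ψ) :
    refState A ⬝ᵥ ((ladderR N * ladderL N) *ᵥ ψ) =
      ((k - A.card) * (Aᶜ.card + 1 - k)) * (refState A ⬝ᵥ ψ) := by
  rw [← Matrix.mulVec_mulVec, Matrix.dotProduct_mulVec, ← ladderL_transpose,
    Matrix.vecMul_transpose, h.lower.dotProduct_congr (g := ((k : ℂ) - A.card) • refState A)]
  · rw [smul_dotProduct, Matrix.dotProduct_mulVec, ← Matrix.mulVec_transpose, ladderL_transpose,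
      smul_eq_mul, mul_assoc]
    rcases hA.eq_or_lt with hA | hA
    · simp [← hA]
    · rw [h.dotProduct_congr (g := ((Aᶜ.card + 1 - k : ℂ)) • refState A)]
      · rw [smul_dotProduct, smul_eq_mul]
      · intro σ hσ
        rw [ladderR_refState A (by omega), ← hσ]
        simp
  · intro σ hσ
    rw [ladderL_refState A (by omega), show k = siteCount 1 Finset.univ σ + 1 by omega]
    simp

lemma InSector.commutator_mulVec {k : ℤ} {ψ : (Fin N → Fin 2) → ℂ} (h : InSector k ψ) :
    (ladderL N * ladderR N) *ᵥ ψ = (ladderR N * ladderL N) *ᵥ ψ + ((N : ℂ) - 2 * k) • ψ := by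
  rw [← h.sum_pauliZ, ← ladder_commutator, Matrix.sub_mulVec]
  abel

lemma ladderL_eq_zero_of_mul {ψ : (Fin N → Fin 2) → ℂ}
    (h : (ladderR N * ladderL N) *ᵥ ψ = 0) : ladderL N *ᵥ ψ = 0 := by
  rw [← ladderL_conjTranspose] at h
  exact (Matrix.conjTranspose_mul_self_mulVec_eq_zero _ _).1 h

lemma ladderR_eq_zero_of_mul {ψ : (Fin N → Fin 2) → ℂ}
    (h : (ladderL N * ladderR N) *ᵥ ψ = 0) : ladderR N *ᵥ ψ = 0 := by
  rw [← ladderR_conjTranspose] at h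
  exact (Matrix.conjTranspose_mul_self_mulVec_eq_zero _ _).1 h

lemma eq_zero_of_posSemidef_mulVec {n : Type*} [Fintype n] {M : Matrix n n ℂ}
    (hM : M.PosSemidef) {ψ : n → ℂ} {c : ℝ} (hc : c < 0) (h : M *ᵥ ψ = (c : ℂ) • ψ) : ψ = 0 := by
  have h1 := hM.dotProduct_mulVec_nonneg ψ
  rw [h, dotProduct_smul, smul_eq_mul] at h1
  have h2 : (0 : ℂ) ≤ star ψ ⬝ᵥ ψ := dotProduct_star_self_nonneg ψ
  rw [← dotProduct_star_self_eq_zero]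
  have hc' : (c : ℂ) < 0 := by exact_mod_cast hc
  by_contra h0
  exact (mul_neg_of_neg_of_pos hc' (lt_of_le_of_ne h2 (Ne.symm h0))).not_ge h1

lemma InSector.eq_zero_of_ladderR {k : ℤ} {ψ : (Fin N → Fin 2) → ℂ} (h : InSector k ψ)
    (hk : 2 * k < N) (hR : ladderR N *ᵥ ψ = 0) : ψ = 0 := by
  have hM : (ladderR N * ladderL N).PosSemidef := by
    rw [← ladderL_conjTranspose]
    exact Matrix.posSemidef_conjTranspose_mul_self _
  have h1 := h.commutator_mulVec
  rw [← Matrix.mulVec_mulVec, hR, Matrix.mulVec_zero] at h1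
  refine eq_zero_of_posSemidef_mulVec hM (c := 2 * k - N) ?_ ?_
  · have : (2 * k : ℝ) < N := by exact_mod_cast hk
    linarith
  · rw [← sub_eq_zero, h1]
    push_cast
    module

lemma InSector.eq_zero_of_ladderL {k : ℤ} {ψ : (Fin N → Fin 2) → ℂ} (h : InSector k ψ)
    (hk : N < 2 * k) (hL : ladderL N *ᵥ ψ = 0) : ψ = 0 := by
  have hM : (ladderL N * ladderR N).PosSemidef := by
    rw [← ladderR_conjTranspose]
    exact Matrix.posSemidef_conjTranspose_mul_self _
  have h1 := h.commutator_mulVec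
  rw [← Matrix.mulVec_mulVec (M := ladderR N), hL, Matrix.mulVec_zero, zero_add] at h1
  refine eq_zero_of_posSemidef_mulVec hM (c := N - 2 * k) ?_ ?_
  · have : (N : ℝ) < 2 * k := by exact_mod_cast hk
    linarith
  · rw [h1]
    push_cast
    rfl

end Sectors

section Heisenberg

open scoped ComplexOrder

variable {N : ℕ}

/-- The weighted Heisenberg Hamiltonian on a finite set of bonds. -/
noncomputable def heisH (P : Finset (Fin N × Fin N)) (w : Fin N → Fin N → ℝ) :
    Matrix (Fin N → Fin 2) (Fin N → Fin 2) ℂ :=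
  -∑ p ∈ P, ((w p.1 p.2 : ℝ) : ℂ) • heisTerm p.1 p.2

variable {P : Finset (Fin N × Fin N)} {w : Fin N → Fin N → ℝ} {A : Finset (Fin N)} {E : ℝ}

lemma ne_of_mem_bonds (hP : ∀ p ∈ P, (p.1 ∈ A ↔ p.2 ∉ A)) : ∀ p ∈ P, p.1 ≠ p.2 := by
  intro p hp h
  have := hP p hp
  rw [h] at this
  tauto

lemma heisH_mulVec (hne : ∀ p ∈ P, p.1 ≠ p.2) (ψ : (Fin N → Fin 2) → ℂ) (σ : Fin N → Fin 2) :
    (heisH P w *ᵥ ψ) σ =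
      ∑ p ∈ P, -((w p.1 p.2 / 2 : ℝ) : ℂ) * (ψ σ - ψ (σ ∘ Equiv.swap p.1 p.2)) := by
  rw [heisH, Matrix.neg_mulVec, Matrix.sum_mulVec, Pi.neg_apply, Finset.sum_apply,
    ← Finset.sum_neg_distrib]
  refine Finset.sum_congr rfl fun p hp => ?_
  rw [Matrix.smul_mulVec, Pi.smul_apply, heisTerm_mulVec (hne p hp), smul_eq_mul]
  push_cast
  ring

lemma heisH_commute (hne : ∀ p ∈ P, p.1 ≠ p.2) (O : Matrix (Fin 2) (Fin 2) ℂ) :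
    heisH P w * (∑ l, localOp O l) = (∑ l, localOp O l) * heisH P w := by
  rw [heisH, neg_mul, mul_neg, Finset.sum_mul (s := P), Finset.mul_sum P]
  congr 1
  refine Finset.sum_congr rfl fun p hp => ?_
  rw [Matrix.smul_mul, heisTerm_mul_sum_localOp (hne p hp), Matrix.mul_smul]

lemma heisH_isHermitian (hne : ∀ p ∈ P, p.1 ≠ p.2) : (heisH P w).IsHermitian := by
  rw [Matrix.IsHermitian, heisH, Matrix.conjTranspose_neg, Matrix.conjTranspose_sum]
  congr 1
  refine Finset.sum_congr rfl fun p hp => ?_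
  rw [Matrix.conjTranspose_smul, (heisTerm_isHermitian (hne p hp)).eq]
  simp

lemma heisH_sectorPart (hne : ∀ p ∈ P, p.1 ≠ p.2) (k : ℤ) (ψ : (Fin N → Fin 2) → ℂ) :
    heisH P w *ᵥ sectorPart k ψ = sectorPart k (heisH P w *ᵥ ψ) := by
  funext σ
  simp only [sectorPart, heisH_mulVec hne, siteCount_univ_comp]
  split_ifs <;> simp

/-- The operator `heisH P w - E` is positive semidefinite if no eigenvalue is below `E`. -/
lemma posSemidef_heisH_sub (hne : ∀ p ∈ P, p.1 ≠ p.2)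
    (hmin : ∀ (E' : ℝ) (ψ : (Fin N → Fin 2) → ℂ), ψ ≠ 0 →
      heisH P w *ᵥ ψ = (E' : ℂ) • ψ → E ≤ E') :
    (heisH P w - (E : ℂ) • 1).PosSemidef := by
  have hM : (heisH P w - (E : ℂ) • 1).IsHermitian := by
    rw [Matrix.IsHermitian, Matrix.conjTranspose_sub, Matrix.conjTranspose_smul,
      (heisH_isHermitian hne).eq]
    simp
  rw [hM.posSemidef_iff_eigenvalues_nonneg]
  intro i
  have h := hM.mulVec_eigenvectorBasis i
  set v := hM.eigenvectorBasis i with hv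
  have hv0 : (v : (Fin N → Fin 2) → ℂ) ≠ 0 := by
    intro h0
    exact hM.eigenvectorBasis.orthonormal.ne_zero i (by ext σ; exact congrFun h0 σ)
  have h' := hmin (hM.eigenvalues i + E) v hv0 (by
    rw [Matrix.sub_mulVec, Matrix.smul_mulVec, Matrix.one_mulVec, sub_eq_iff_eq_add] at h
    rw [h]
    funext σ
    simp [add_mul])
  simpa using h'

/-- The state whose coefficients are `‖ψ σ‖` up to the Marshall signs. -/
noncomputable def marshallAbs (A : Finset (Fin N)) (ψ : (Fin N → Fin 2) → ℂ) :
    (Fin N → Fin 2) → ℂ :=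
  fun σ => ((marshallSign A σ * ‖ψ σ‖ : ℝ) : ℂ)

lemma marshallAbs_eq_zero_iff {ψ : (Fin N → Fin 2) → ℂ} {σ : Fin N → Fin 2} :
    marshallAbs A ψ σ = 0 ↔ ψ σ = 0 := by
  simp [marshallAbs, marshallSign]

lemma heisH_mulVec_marshallAbs (hP : ∀ p ∈ P, (p.1 ∈ A ↔ p.2 ∉ A))
    (hw : ∀ p ∈ P, 0 < w p.1 p.2) (hpos : (heisH P w - (E : ℂ) • 1).PosSemidef)
    {ψ : (Fin N → Fin 2) → ℂ} (h : heisH P w *ᵥ ψ = (E : ℂ) • ψ) :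
    heisH P w *ᵥ marshallAbs A ψ = (E : ℂ) • marshallAbs A ψ := by
  have hne := ne_of_mem_bonds hP
  have hM : ∀ f : (Fin N → Fin 2) → ℂ,
      (heisH P w - (E : ℂ) • 1) *ᵥ f = heisH P w *ᵥ f - (E : ℂ) • f := fun f => by
    rw [Matrix.sub_mulVec, Matrix.smul_mulVec, Matrix.one_mulVec]
  rw [← sub_eq_zero, ← hM, ← hpos.dotProduct_mulVec_zero_iff]
  have h0 : star ψ ⬝ᵥ ((heisH P w - (E : ℂ) • 1) *ᵥ ψ) = 0 := by
    rw [hM, h, sub_self, dotProduct_zero]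
  have h1 := hpos.dotProduct_mulVec_nonneg (marshallAbs A ψ)
  refine le_antisymm ?_ h1
  rw [Complex.le_def] at h1 ⊢
  refine ⟨?_, h1.2.symm⟩
  rw [← h0]
  simp only [dotProduct, Complex.re_sum, hM, Pi.star_apply, Pi.sub_apply, Pi.smul_apply,
    heisH_mulVec hne]
  refine Finset.sum_le_sum fun σ _ => ?_
  have hs := marshallSign_mul_self A σ
  have hsq : star (marshallAbs A ψ σ) * marshallAbs A ψ σ = star (ψ σ) * ψ σ := by
    simp only [marshallAbs, Complex.star_def, Complex.conj_ofReal, Complex.conj_mul']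
    norm_cast
    linear_combination ‖ψ σ‖ ^ 2 * hs
  rw [mul_sub, mul_sub, Complex.sub_re, Complex.sub_re, smul_eq_mul, smul_eq_mul, mul_left_comm,
    hsq, mul_left_comm (star (ψ σ))]
  refine sub_le_sub_right ?_ _
  rw [Finset.mul_sum, Finset.mul_sum, Complex.re_sum, Complex.re_sum]
  refine Finset.sum_le_sum fun p hp => ?_
  rw [mul_left_comm, mul_left_comm (star (ψ σ)), mul_sub (star (marshallAbs A ψ σ)),
    mul_sub (star (ψ σ)), hsq, ← Complex.ofReal_neg,
    Complex.re_ofReal_mul, Complex.re_ofReal_mul, Complex.sub_re, Complex.sub_re]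
  refine mul_le_mul_of_nonpos_left (sub_le_sub_left ?_ _) (by linarith [hw p hp])
  by_cases hσ : σ p.1 = σ p.2
  · rw [comp_swap_eq_self hσ, hsq]
  · rw [marshallAbs, marshallAbs, marshallSign_swap A (hP p hp) hσ]
    have h2 := Complex.abs_re_le_norm (star (ψ σ) * ψ (σ ∘ Equiv.swap p.1 p.2))
    rw [norm_mul, norm_star] at h2
    simp only [Complex.star_def, Complex.conj_ofReal, ← Complex.ofReal_mul, Complex.ofReal_re]
    have := neg_le_of_abs_le h2
    simp only [Complex.star_def] at this
    linear_combination this - (‖ψ σ‖ * ‖ψ (σ ∘ Equiv.swap p.1 p.2)‖) * hs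

/-- An eigenvector at energy `E` in the sector with `k` ones. -/
structure IsGround (P : Finset (Fin N × Fin N)) (w : Fin N → Fin N → ℝ) (E : ℝ) (k : ℤ)
    (ψ : (Fin N → Fin 2) → ℂ) : Prop where
  eigen : heisH P w *ᵥ ψ = (E : ℂ) • ψ
  inSector : InSector k ψ

variable {k : ℤ} {ψ : (Fin N → Fin 2) → ℂ}

lemma IsGround.lower (hne : ∀ p ∈ P, p.1 ≠ p.2) (h : IsGround P w E k ψ) :
    IsGround P w E (k - 1) (ladderL N *ᵥ ψ) where
  eigen := by
    rw [ladderL, Matrix.mulVec_mulVec, heisH_commute hne, ← Matrix.mulVec_mulVec, h.eigen,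
      Matrix.mulVec_smul]
  inSector := h.inSector.lower

lemma IsGround.raise (hne : ∀ p ∈ P, p.1 ≠ p.2) (h : IsGround P w E k ψ) :
    IsGround P w E (k + 1) (ladderR N *ᵥ ψ) where
  eigen := by
    rw [ladderR, Matrix.mulVec_mulVec, heisH_commute hne, ← Matrix.mulVec_mulVec, h.eigen,
      Matrix.mulVec_smul]
  inSector := h.inSector.raise

lemma IsGround.sub_smul {φ : (Fin N → Fin 2) → ℂ} (h : IsGround P w E k ψ)
    (h' : IsGround P w E k φ) (c : ℂ) : IsGround P w E k (ψ - c • φ) where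
  eigen := by
    rw [Matrix.mulVec_sub, Matrix.mulVec_smul, h.eigen, h'.eigen, smul_sub, smul_comm]
  inSector σ hσ := by
    by_cases h0 : ψ σ = 0
    · exact h'.inSector σ (by rintro h1; simp [h0, h1] at hσ)
    · exact h.inSector σ h0

lemma isGround_sectorPart (hne : ∀ p ∈ P, p.1 ≠ p.2) (h : heisH P w *ᵥ ψ = (E : ℂ) • ψ) (k : ℤ) :
    IsGround P w E k (sectorPart k ψ) where
  eigen := by
    rw [heisH_sectorPart hne, h]
    funext σ
    simp [sectorPart]
  inSector := inSector_sectorPart k ψ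

lemma IsGround.marshallAbs (hP : ∀ p ∈ P, (p.1 ∈ A ↔ p.2 ∉ A))
    (hw : ∀ p ∈ P, 0 < w p.1 p.2) (hpos : (heisH P w - (E : ℂ) • 1).PosSemidef)
    (h : IsGround P w E k ψ) : IsGround P w E k (marshallAbs A ψ) where
  eigen := heisH_mulVec_marshallAbs hP hw hpos h.eigen
  inSector σ hσ := h.inSector σ (mt marshallAbs_eq_zero_iff.2 hσ)

lemma apply_swap_eq_zero (hP : ∀ p ∈ P, (p.1 ∈ A ↔ p.2 ∉ A))
    (hw : ∀ p ∈ P, 0 < w p.1 p.2) (hpos : (heisH P w - (E : ℂ) • 1).PosSemidef)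
    (h : heisH P w *ᵥ ψ = (E : ℂ) • ψ) {σ : Fin N → Fin 2} (hσ : ψ σ = 0)
    {p : Fin N × Fin N} (hp : p ∈ P) : ψ (σ ∘ Equiv.swap p.1 p.2) = 0 := by
  have h1 := congrFun (heisH_mulVec_marshallAbs hP hw hpos h) σ
  have hterm : ∀ q ∈ P, marshallAbs A ψ (σ ∘ Equiv.swap q.1 q.2) =
      -((marshallSign A σ * ‖ψ (σ ∘ Equiv.swap q.1 q.2)‖ : ℝ) : ℂ) := by
    intro q hq
    by_cases hq' : σ q.1 = σ q.2
    · simp [comp_swap_eq_self hq', _root_.marshallAbs, hσ]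
    · simp [_root_.marshallAbs, marshallSign_swap A (hP q hq) hq']
  rw [heisH_mulVec (ne_of_mem_bonds hP), Pi.smul_apply, marshallAbs_eq_zero_iff.2 hσ, smul_zero,
    Finset.sum_congr rfl (g := fun q => -(marshallSign A σ : ℂ) *
      ((w q.1 q.2 / 2 * ‖ψ (σ ∘ Equiv.swap q.1 q.2)‖ : ℝ) : ℂ)), ← Finset.mul_sum] at h1
  · have hs : -(marshallSign A σ : ℂ) ≠ 0 := by simp [marshallSign]
    have h2 := (mul_eq_zero.1 h1).resolve_left hs
    rw [← Complex.ofReal_sum, Complex.ofReal_eq_zero, Finset.sum_eq_zero_iff_of_nonneg] at h2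
    · have := h2 p hp
      have hwp := hw p hp
      rcases mul_eq_zero.1 this with h3 | h3
      · linarith
      · exact norm_eq_zero.1 h3
    · intro q hq
      have := hw q hq
      positivity
  · intro q hq
    rw [hterm q hq]
    push_cast
    ring

lemma IsGround.eq_zero_of_apply_eq_zero (hP : ∀ p ∈ P, (p.1 ∈ A ↔ p.2 ∉ A))
    (hw : ∀ p ∈ P, 0 < w p.1 p.2) (hpos : (heisH P w - (E : ℂ) • 1).PosSemidef)
    (hconn : Subgroup.closure {π : Equiv.Perm (Fin N) | ∃ p ∈ P, π = Equiv.swap p.1 p.2} = ⊤)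
    (h : IsGround P w E k ψ) {σ : Fin N → Fin 2} (hk : (siteCount 1 Finset.univ σ : ℤ) = k)
    (hσ : ψ σ = 0) : ψ = 0 := by
  have key : ∀ π ∈ Subgroup.closure {π : Equiv.Perm (Fin N) | ∃ p ∈ P, π = Equiv.swap p.1 p.2},
      ∀ σ, ψ σ = 0 ↔ ψ (σ ∘ π) = 0 := by
    intro π hπ
    induction hπ using Subgroup.closure_induction with
    | mem π hπ =>
      obtain ⟨p, hp, rfl⟩ := hπ
      intro σ
      refine ⟨fun h0 => apply_swap_eq_zero hP hw hpos h.eigen h0 hp, fun h0 => ?_⟩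
      have := apply_swap_eq_zero hP hw hpos h.eigen h0 hp
      rwa [Function.comp_assoc, ← Equiv.Perm.coe_mul, Equiv.swap_mul_self, Equiv.Perm.coe_one,
        Function.comp_id] at this
    | one => intro σ; rw [Equiv.Perm.coe_one, Function.comp_id]
    | mul π ρ _ _ hπ hρ =>
      intro σ
      rw [hπ σ, hρ (σ ∘ π), Equiv.Perm.coe_mul, Function.comp_assoc]
    | inv π _ hπ =>
      intro σ
      rw [hπ (σ ∘ ↑π⁻¹), Function.comp_assoc, ← Equiv.Perm.coe_mul, inv_mul_cancel,
        Equiv.Perm.coe_one, Function.comp_id]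
  funext τ
  by_contra hτ
  have hτk := h.inSector τ hτ
  obtain ⟨π, rfl⟩ := exists_perm_of_siteCount_eq (σ := σ) (τ := τ) (by omega)
  exact hτ ((key π (by rw [hconn]; trivial) σ).1 hσ)

lemma IsGround.eq_smul (hP : ∀ p ∈ P, (p.1 ∈ A ↔ p.2 ∉ A))
    (hw : ∀ p ∈ P, 0 < w p.1 p.2) (hpos : (heisH P w - (E : ℂ) • 1).PosSemidef)
    (hconn : Subgroup.closure {π : Equiv.Perm (Fin N) | ∃ p ∈ P, π = Equiv.swap p.1 p.2} = ⊤)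
    {φ : (Fin N → Fin 2) → ℂ} (h : IsGround P w E k ψ) (h' : IsGround P w E k φ) (hφ : φ ≠ 0) :
    ∃ c : ℂ, ψ = c • φ := by
  obtain ⟨σ, hσ⟩ := Function.ne_iff.1 hφ
  refine ⟨ψ σ / φ σ, sub_eq_zero.1 ?_⟩
  refine (h.sub_smul h' _).eq_zero_of_apply_eq_zero hP hw hpos hconn (h'.inSector σ hσ) ?_
  simp [div_mul_cancel₀ (ψ σ) hσ]

lemma refState_dotProduct_marshallAbs_ne_zero (hψ : ψ ≠ 0) :
    refState A ⬝ᵥ marshallAbs A ψ ≠ 0 := by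
  choose c hc hcA using fun σ => refState_eq_marshallSign A σ
  have h : refState A ⬝ᵥ marshallAbs A ψ = ((∑ σ, c σ * ‖ψ σ‖ : ℝ) : ℂ) := by
    rw [dotProduct, Complex.ofReal_sum]
    refine Finset.sum_congr rfl fun σ _ => ?_
    rw [hcA, _root_.marshallAbs, ← Complex.ofReal_mul]
    congr 1
    linear_combination (c σ * ‖ψ σ‖) * marshallSign_mul_self A σ
  rw [h, Complex.ofReal_ne_zero]
  obtain ⟨σ, hσ⟩ := Function.ne_iff.1 hψ
  refine (Finset.sum_pos' (fun τ _ => mul_nonneg (hc τ).le (norm_nonneg _))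
    ⟨σ, Finset.mem_univ _, mul_pos (hc σ) (norm_pos_iff.2 hσ)⟩).ne'

lemma IsGround.ladder_eigen (hP : ∀ p ∈ P, (p.1 ∈ A ↔ p.2 ∉ A))
    (hw : ∀ p ∈ P, 0 < w p.1 p.2) (hpos : (heisH P w - (E : ℂ) • 1).PosSemidef)
    (hconn : Subgroup.closure {π : Equiv.Perm (Fin N) | ∃ p ∈ P, π = Equiv.swap p.1 p.2} = ⊤)
    (hA : A.card ≤ k) (hB : k ≤ Aᶜ.card) (h : IsGround P w E k ψ) :
    (ladderR N * ladderL N) *ᵥ ψ = (((k : ℂ) - A.card) * (Aᶜ.card + 1 - k)) • ψ := by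
  have hne := ne_of_mem_bonds hP
  by_cases hψ : ψ = 0
  · simp [hψ]
  set g := _root_.marshallAbs A ψ with hg_def
  have hov : refState A ⬝ᵥ g ≠ 0 := refState_dotProduct_marshallAbs_ne_zero hψ
  have hg0 : g ≠ 0 := by
    intro h0
    rw [h0, dotProduct_zero] at hov
    exact hov rfl
  have hg : IsGround P w E k g := h.marshallAbs hP hw hpos
  have hRL : IsGround P w E k ((ladderR N * ladderL N) *ᵥ g) := by
    rw [← Matrix.mulVec_mulVec]
    simpa using (hg.lower hne).raise hne
  obtain ⟨l, hl⟩ := hRL.eq_smul hP hw hpos hconn hg hg0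
  obtain ⟨c, hc⟩ := h.eq_smul hP hw hpos hconn hg hg0
  have h1 := refState_dotProduct_ladder A hA hB hg.inSector
  rw [hl, dotProduct_smul, smul_eq_mul] at h1
  rw [hc, Matrix.mulVec_smul, hl, mul_right_cancel₀ hov h1, smul_comm]

end Heisenberg

section GroundSpace

open scoped ComplexOrder

variable {N : ℕ} {P : Finset (Fin N × Fin N)} {w : Fin N → Fin N → ℝ} {A : Finset (Fin N)}
  {E : ℝ} {k : ℤ} {ψ : (Fin N → Fin 2) → ℂ}

lemma card_add_card_compl_eq (A : Finset (Fin N)) : A.card + Aᶜ.card = N := by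
  rw [Finset.card_add_card_compl, Fintype.card_fin]

lemma IsGround.eq_zero_of_lt (hP : ∀ p ∈ P, (p.1 ∈ A ↔ p.2 ∉ A))
    (hw : ∀ p ∈ P, 0 < w p.1 p.2) (hpos : (heisH P w - (E : ℂ) • 1).PosSemidef)
    (hconn : Subgroup.closure {π : Equiv.Perm (Fin N) | ∃ p ∈ P, π = Equiv.swap p.1 p.2} = ⊤)
    (hAB : A.card ≤ Aᶜ.card) (hk : k < A.card) (h : IsGround P w E k ψ) : ψ = 0 := by
  have hne := ne_of_mem_bonds hP
  have hN := card_add_card_compl_eq A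
  obtain ⟨n, hn⟩ : ∃ n : ℕ, k + 1 + n = A.card := ⟨(A.card - (k + 1)).toNat, by omega⟩
  induction n generalizing k ψ with
  | zero =>
    refine h.inSector.eq_zero_of_ladderR (by omega) (ladderR_eq_zero_of_mul ?_)
    rw [← Matrix.mulVec_mulVec]
    refine ladderL_eq_zero_of_mul ?_
    have hk' : k + 1 = A.card := by simpa using hn
    rw [(h.raise hne).ladder_eigen hP hw hpos hconn (by omega) (by omega), hk']
    simp
  | succ n ih =>
    refine h.inSector.eq_zero_of_ladderR (by omega) (ih (by omega) (h.raise hne) ?_)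
    push_cast at hn
    omega

lemma IsGround.eq_zero_of_gt (hP : ∀ p ∈ P, (p.1 ∈ A ↔ p.2 ∉ A))
    (hw : ∀ p ∈ P, 0 < w p.1 p.2) (hpos : (heisH P w - (E : ℂ) • 1).PosSemidef)
    (hconn : Subgroup.closure {π : Equiv.Perm (Fin N) | ∃ p ∈ P, π = Equiv.swap p.1 p.2} = ⊤)
    (hAB : A.card ≤ Aᶜ.card) (hk : Aᶜ.card < k) (h : IsGround P w E k ψ) : ψ = 0 := by
  have hne := ne_of_mem_bonds hP
  have hN := card_add_card_compl_eq A
  obtain ⟨n, hn⟩ : ∃ n : ℕ, k - 1 - n = Aᶜ.card := ⟨(k - 1 - Aᶜ.card).toNat, by omega⟩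
  induction n generalizing k ψ with
  | zero =>
    refine h.inSector.eq_zero_of_ladderL (by omega) (ladderL_eq_zero_of_mul ?_)
    rw [← Matrix.mulVec_mulVec]
    refine ladderR_eq_zero_of_mul ?_
    have hk' : k - 1 = Aᶜ.card := by simpa using hn
    have hN' : (N : ℂ) = A.card + Aᶜ.card := by exact_mod_cast hN.symm
    rw [(h.lower hne).inSector.commutator_mulVec,
      (h.lower hne).ladder_eigen hP hw hpos hconn (by omega) (by omega), hk', ← add_smul, hN',
      show ((((Aᶜ.card : ℕ) : ℤ) : ℂ) - A.card) * (Aᶜ.card + 1 - ((Aᶜ.card : ℕ) : ℤ)) +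
        (A.card + Aᶜ.card - 2 * ((Aᶜ.card : ℕ) : ℤ)) = 0 by push_cast; ring, zero_smul]
  | succ n ih =>
    refine h.inSector.eq_zero_of_ladderL (by omega) (ih (by omega) (h.lower hne) ?_)
    push_cast at hn
    omega

lemma IsGround.mem_Icc (hP : ∀ p ∈ P, (p.1 ∈ A ↔ p.2 ∉ A))
    (hw : ∀ p ∈ P, 0 < w p.1 p.2) (hpos : (heisH P w - (E : ℂ) • 1).PosSemidef)
    (hconn : Subgroup.closure {π : Equiv.Perm (Fin N) | ∃ p ∈ P, π = Equiv.swap p.1 p.2} = ⊤)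
    (hAB : A.card ≤ Aᶜ.card) (h : IsGround P w E k ψ) (hψ : ψ ≠ 0) :
    (A.card : ℤ) ≤ k ∧ k ≤ Aᶜ.card :=
  ⟨not_lt.1 fun hk => hψ (h.eq_zero_of_lt hP hw hpos hconn hAB hk),
    not_lt.1 fun hk => hψ (h.eq_zero_of_gt hP hw hpos hconn hAB hk)⟩

lemma IsGround.lower_ne_zero (hP : ∀ p ∈ P, (p.1 ∈ A ↔ p.2 ∉ A))
    (hw : ∀ p ∈ P, 0 < w p.1 p.2) (hpos : (heisH P w - (E : ℂ) • 1).PosSemidef)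
    (hconn : Subgroup.closure {π : Equiv.Perm (Fin N) | ∃ p ∈ P, π = Equiv.swap p.1 p.2} = ⊤)
    (hA : A.card < k) (hB : k ≤ Aᶜ.card) (h : IsGround P w E k ψ) (hψ : ψ ≠ 0) :
    ladderL N *ᵥ ψ ≠ 0 := by
  intro h0
  have h1 := h.ladder_eigen hP hw hpos hconn hA.le hB
  rw [← Matrix.mulVec_mulVec, h0, Matrix.mulVec_zero] at h1
  have h2 := (smul_eq_zero.1 h1.symm).resolve_right hψ
  have h3 : (k - A.card) * (Aᶜ.card + 1 - k) = 0 := by exact_mod_cast h2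
  rcases mul_eq_zero.1 h3 with h4 | h4 <;> omega

lemma IsGround.ladder_eigen' (hP : ∀ p ∈ P, (p.1 ∈ A ↔ p.2 ∉ A))
    (hw : ∀ p ∈ P, 0 < w p.1 p.2) (hpos : (heisH P w - (E : ℂ) • 1).PosSemidef)
    (hconn : Subgroup.closure {π : Equiv.Perm (Fin N) | ∃ p ∈ P, π = Equiv.swap p.1 p.2} = ⊤)
    (hA : A.card ≤ k) (hB : k ≤ Aᶜ.card) (h : IsGround P w E k ψ) :
    (ladderL N * ladderR N) *ᵥ ψ = (((k : ℂ) + 1 - A.card) * (Aᶜ.card - k)) • ψ := by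
  have hN : (N : ℂ) = A.card + Aᶜ.card := by exact_mod_cast (card_add_card_compl_eq A).symm
  rw [h.inSector.commutator_mulVec, h.ladder_eigen hP hw hpos hconn hA hB, ← add_smul, hN]
  congr 1
  ring

lemma IsGround.raise_ne_zero (hP : ∀ p ∈ P, (p.1 ∈ A ↔ p.2 ∉ A))
    (hw : ∀ p ∈ P, 0 < w p.1 p.2) (hpos : (heisH P w - (E : ℂ) • 1).PosSemidef)
    (hconn : Subgroup.closure {π : Equiv.Perm (Fin N) | ∃ p ∈ P, π = Equiv.swap p.1 p.2} = ⊤)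
    (hA : A.card ≤ k) (hB : k < Aᶜ.card) (h : IsGround P w E k ψ) (hψ : ψ ≠ 0) :
    ladderR N *ᵥ ψ ≠ 0 := by
  intro h0
  have h1 := h.ladder_eigen' hP hw hpos hconn hA hB.le
  rw [← Matrix.mulVec_mulVec, h0, Matrix.mulVec_zero] at h1
  have h2 := (smul_eq_zero.1 h1.symm).resolve_right hψ
  have h3 : (k + 1 - A.card) * (Aᶜ.card - k) = 0 := by exact_mod_cast h2
  rcases mul_eq_zero.1 h3 with h4 | h4 <;> omega

lemma exists_isGround (hP : ∀ p ∈ P, (p.1 ∈ A ↔ p.2 ∉ A))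
    (hw : ∀ p ∈ P, 0 < w p.1 p.2) (hpos : (heisH P w - (E : ℂ) • 1).PosSemidef)
    (hconn : Subgroup.closure {π : Equiv.Perm (Fin N) | ∃ p ∈ P, π = Equiv.swap p.1 p.2} = ⊤)
    (hAB : A.card ≤ Aᶜ.card) (h : heisH P w *ᵥ ψ = (E : ℂ) • ψ) (hψ : ψ ≠ 0)
    (hA : A.card ≤ k) (hB : k ≤ Aᶜ.card) : ∃ φ, IsGround P w E k φ ∧ φ ≠ 0 := by
  have hne := ne_of_mem_bonds hP
  obtain ⟨σ, hσ⟩ := Function.ne_iff.1 hψ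
  set m : ℤ := (siteCount 1 Finset.univ σ : ℤ) with hm
  have hg := isGround_sectorPart hne h m
  have hg0 : sectorPart m ψ ≠ 0 := fun h0 => hσ (by simpa [sectorPart, ← hm] using congrFun h0 σ)
  have hmI := hg.mem_Icc hP hw hpos hconn hAB hg0
  rcases le_total k m with hkm | hkm
  · induction k, hkm using Int.leInductionDown with
    | base => exact ⟨_, hg, hg0⟩
    | pred n hn ih =>
      obtain ⟨φ, hφ, hφ0⟩ := ih (by omega) (by omega)
      exact ⟨_, hφ.lower hne,
        hφ.lower_ne_zero hP hw hpos hconn (by omega) (by omega) hφ0⟩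
  · induction k, hkm using Int.leInduction with
    | base => exact ⟨_, hg, hg0⟩
    | succ n hn ih =>
      obtain ⟨φ, hφ, hφ0⟩ := ih (by omega) (by omega)
      exact ⟨_, hφ.raise hne,
        hφ.raise_ne_zero hP hw hpos hconn (by omega) (by omega) hφ0⟩

lemma totalSpinSq_mulVec_of_eigen (hP : ∀ p ∈ P, (p.1 ∈ A ↔ p.2 ∉ A))
    (hw : ∀ p ∈ P, 0 < w p.1 p.2) (hpos : (heisH P w - (E : ℂ) • 1).PosSemidef)
    (hconn : Subgroup.closure {π : Equiv.Perm (Fin N) | ∃ p ∈ P, π = Equiv.swap p.1 p.2} = ⊤)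
    (hAB : A.card ≤ Aᶜ.card) (h : heisH P w *ᵥ ψ = (E : ℂ) • ψ) :
    totalSpinSq N *ᵥ ψ =
      (((Aᶜ.card : ℂ) - A.card) * (Aᶜ.card - A.card + 2)) • ψ := by
  have hne := ne_of_mem_bonds hP
  have hN : (N : ℂ) = A.card + Aᶜ.card := by exact_mod_cast (card_add_card_compl_eq A).symm
  rw [← sum_sectorPart ψ, Matrix.mulVec_sum, Finset.smul_sum]
  refine Finset.sum_congr rfl fun k _ => ?_
  have hg := isGround_sectorPart hne h k
  by_cases h0 : sectorPart (k : ℤ) ψ = 0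
  · simp [h0]
  obtain ⟨hA, hB⟩ := hg.mem_Icc hP hw hpos hconn hAB h0
  rw [totalSpinSq_eq, Matrix.add_mulVec, Matrix.smul_mulVec, Matrix.add_mulVec,
    hg.ladder_eigen hP hw hpos hconn hA hB, hg.ladder_eigen' hP hw hpos hconn hA hB,
    ← Matrix.mulVec_mulVec, hg.inSector.sum_pauliZ, Matrix.mulVec_smul, hg.inSector.sum_pauliZ,
    hN]
  module

lemma finrank_eigenspace_heisH (hP : ∀ p ∈ P, (p.1 ∈ A ↔ p.2 ∉ A))
    (hw : ∀ p ∈ P, 0 < w p.1 p.2) (hpos : (heisH P w - (E : ℂ) • 1).PosSemidef)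
    (hconn : Subgroup.closure {π : Equiv.Perm (Fin N) | ∃ p ∈ P, π = Equiv.swap p.1 p.2} = ⊤)
    (hAB : A.card ≤ Aᶜ.card) (h : heisH P w *ᵥ ψ = (E : ℂ) • ψ) (hψ : ψ ≠ 0) :
    Module.finrank ℂ ↥(Module.End.eigenspace (Matrix.mulVecLin (heisH P w)) (E : ℂ)) =
      Aᶜ.card - A.card + 1 := by
  classical
  have hne := ne_of_mem_bonds hP
  let I := Finset.Icc (A.card : ℤ) Aᶜ.card
  choose φ hφ hφ0 using fun k : I => exists_isGround (k := k) hP hw hpos hconn hAB h hψ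
    (Finset.mem_Icc.1 k.2).1 (Finset.mem_Icc.1 k.2).2
  choose τ hτ using fun k : I => Function.ne_iff.1 (hφ0 k)
  have hτk : ∀ k : I, (siteCount 1 Finset.univ (τ k) : ℤ) = k := fun k =>
    (hφ k).inSector _ (hτ k)
  let V := Module.End.eigenspace (Matrix.mulVecLin (heisH P w)) (E : ℂ)
  have hV : ∀ f, f ∈ V ↔ heisH P w *ᵥ f = (E : ℂ) • f := fun f => by
    rw [Module.End.mem_eigenspace_iff, Matrix.mulVecLin_apply]
  let F : V →ₗ[ℂ] (I → ℂ) := (LinearMap.funLeft ℂ ℂ τ).comp V.subtype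
  have hF : ∀ (f : V) (k : I), F f k = (f : (Fin N → Fin 2) → ℂ) (τ k) := fun f k => rfl
  have hinj : Function.Injective F := by
    rw [injective_iff_map_eq_zero]
    intro f hf
    have hpart : ∀ k : ℤ, sectorPart k (f : (Fin N → Fin 2) → ℂ) = 0 := by
      intro k
      by_contra h0
      have hg := isGround_sectorPart hne ((hV _).1 f.2) k
      have hk := hg.mem_Icc hP hw hpos hconn hAB h0
      let k' : I := ⟨k, Finset.mem_Icc.2 hk⟩
      refine h0 (hg.eq_zero_of_apply_eq_zero hP hw hpos hconn (hτk k') ?_)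
      have := congrFun hf k'
      rw [hF] at this
      simp [sectorPart, this]
    refine Subtype.ext ?_
    rw [← sum_sectorPart (f : (Fin N → Fin 2) → ℂ)]
    simp [hpart]
  have hsurj : Function.Surjective F := by
    intro c
    refine ⟨∑ k : I, (c k / φ k (τ k)) • ⟨φ k, (hV _).2 (hφ k).eigen⟩, funext fun l => ?_⟩
    rw [map_sum, Finset.sum_apply, Finset.sum_eq_single l]
    · rw [map_smul, Pi.smul_apply, hF, smul_eq_mul, div_mul_cancel₀ _ (hτ l)]
    · intro k _ hkl
      rw [map_smul, Pi.smul_apply, hF]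
      have : φ k (τ l) = 0 := by
        by_contra h0
        exact hkl (Subtype.ext (((hφ k).inSector _ h0).symm.trans (hτk l)))
      simp [this]
    · simp
  rw [(LinearEquiv.ofBijective F ⟨hinj, hsurj⟩).finrank_eq, Module.finrank_fintype_fun_eq_card,
    Fintype.card_coe, Int.card_Icc]
  omega

/-- Transpositions along the edges of a connected graph generate the symmetric group. -/
lemma closure_swap_eq_top_of_connected {G : SimpleGraph (Fin N)} (hG : G.Connected)
    (hP : ∀ p ∈ P, p.1 ≠ p.2) (hGP : ∀ i j, G.Adj i j → (i, j) ∈ P ∨ (j, i) ∈ P) :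
    Subgroup.closure {π : Equiv.Perm (Fin N) | ∃ p ∈ P, π = Equiv.swap p.1 p.2} = ⊤ := by
  set S := {π : Equiv.Perm (Fin N) | ∃ p ∈ P, π = Equiv.swap p.1 p.2} with hS
  have : MulAction.IsPretransitive (Subgroup.closure S) (Fin N) := by
    refine ⟨fun i j => ?_⟩
    obtain ⟨p⟩ := hG.preconnected i j
    induction p with
    | nil => exact ⟨1, one_smul _ _⟩
    | @cons u v x huv _ ih =>
      obtain ⟨g, hg⟩ := ih
      have hmem : Equiv.swap u v ∈ S := by
        rcases hGP u v huv with h | h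
        · exact ⟨_, h, rfl⟩
        · exact ⟨_, h, Equiv.swap_comm _ _⟩
      refine ⟨g * ⟨Equiv.swap u v, Subgroup.subset_closure hmem⟩, ?_⟩
      rw [mul_smul, ← hg]
      congr 1
      exact Equiv.swap_apply_left u v
  refine closure_of_isSwap_of_isPretransitive fun π hπ => ?_
  obtain ⟨p, hp, rfl⟩ := hπ
  exact ⟨p.1, p.2, hP p hp, rfl⟩

end GroundSpace

/-- **Lieb–Mattis.** For the antiferromagnetic Heisenberg model with
positive weights on a connected bipartite graph with parts `𝒜, ℬ`, every ground state
is an eigenvector of `Ŝ²` with eigenvalue `4S(S+1)` where `S = ||𝒜|−|ℬ||/2`, and the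
ground eigenspace has dimension exactly `||𝒜|−|ℬ|| + 1`. -/
theorem lieb_mattis {N : ℕ}
    (G : SimpleGraph (Fin N)) [DecidableRel G.Adj] (hG : G.Connected)
    (A : Finset (Fin N)) (hbip : ∀ i j, G.Adj i j → (i ∈ A ↔ j ∉ A))
    (w : Fin N → Fin N → ℝ) (hw : ∀ i j, G.Adj i j → 0 < w i j)
    (E0 : ℝ)
    (hE0exists : ∃ ψ : (Fin N → Fin 2) → ℂ, ψ ≠ 0 ∧
      (-∑ p ∈ Finset.univ.filter (fun p : Fin N × Fin N => G.Adj p.1 p.2 ∧ p.1 ∈ A),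
          ((w p.1 p.2 : ℝ) : ℂ) • heisTerm p.1 p.2) *ᵥ ψ = (E0 : ℂ) • ψ)
    (hE0min : ∀ (E' : ℝ) (ψ : (Fin N → Fin 2) → ℂ), ψ ≠ 0 →
      (-∑ p ∈ Finset.univ.filter (fun p : Fin N × Fin N => G.Adj p.1 p.2 ∧ p.1 ∈ A),
          ((w p.1 p.2 : ℝ) : ℂ) • heisTerm p.1 p.2) *ᵥ ψ = (E' : ℂ) • ψ → E0 ≤ E') :
    let H : Matrix (Fin N → Fin 2) (Fin N → Fin 2) ℂ :=
      -∑ p ∈ Finset.univ.filter (fun p : Fin N × Fin N => G.Adj p.1 p.2 ∧ p.1 ∈ A),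
        ((w p.1 p.2 : ℝ) : ℂ) • heisTerm p.1 p.2;
    let S : ℝ := |(A.card : ℝ) - ((Aᶜ : Finset (Fin N)).card : ℝ)| / 2;
    (∀ ψ : (Fin N → Fin 2) → ℂ, H *ᵥ ψ = (E0 : ℂ) • ψ →
        totalSpinSq N *ᵥ ψ = (((4 * S * (S + 1) : ℝ)) : ℂ) • ψ) ∧
    Module.finrank ℂ
        ↥(Module.End.eigenspace (Matrix.mulVecLin H) ((E0 : ℝ) : ℂ)) =
      ((A.card : ℤ) - ((Aᶜ : Finset (Fin N)).card : ℤ)).natAbs + 1 := by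
  intro H S
  set P := Finset.univ.filter (fun p : Fin N × Fin N => G.Adj p.1 p.2 ∧ p.1 ∈ A) with hPdef
  have hmem : ∀ p ∈ P, G.Adj p.1 p.2 ∧ p.1 ∈ A := fun p hp => by simpa [hPdef] using hp
  have hH : H = heisH P w := rfl
  have hP : ∀ p ∈ P, (p.1 ∈ A ↔ p.2 ∉ A) := fun p hp => hbip _ _ (hmem p hp).1
  have hne := ne_of_mem_bonds hP
  have hwP : ∀ p ∈ P, 0 < w p.1 p.2 := fun p hp => hw _ _ (hmem p hp).1
  have hpos := posSemidef_heisH_sub (P := P) (w := w) (E := E0) hne hE0min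
  have hconn := closure_swap_eq_top_of_connected (P := P) hG hne fun i j hij => by
    by_cases hi : i ∈ A
    · exact Or.inl (by simp [hPdef, hij, hi])
    · exact Or.inr (by simp [hPdef, hij.symm, (hbip j i hij.symm).2 hi])
  obtain ⟨ψ₀, hψ₀, hψ₀E⟩ := hE0exists
  rw [hH]
  rcases le_total A.card Aᶜ.card with hAB | hAB
  · have hAB' : (A.card : ℝ) ≤ Aᶜ.card := by exact_mod_cast hAB
    refine ⟨fun ψ hψ => ?_, ?_⟩
    · rw [totalSpinSq_mulVec_of_eigen hP hwP hpos hconn hAB hψ]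
      congr 1
      simp only [S, abs_of_nonpos (sub_nonpos.2 hAB')]
      push_cast
      ring
    · rw [finrank_eigenspace_heisH hP hwP hpos hconn hAB hψ₀E hψ₀]
      omega
  · have hAB' : (Aᶜ.card : ℝ) ≤ A.card := by exact_mod_cast hAB
    have hP' : ∀ p ∈ P, (p.1 ∈ Aᶜ ↔ p.2 ∉ Aᶜ) := fun p hp => by
      have := hP p hp
      simp only [Finset.mem_compl]
      tauto
    have hAB'' : Aᶜ.card ≤ Aᶜᶜ.card := by rwa [compl_compl]
    refine ⟨fun ψ hψ => ?_, ?_⟩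
    · rw [totalSpinSq_mulVec_of_eigen hP' hwP hpos hconn hAB'' hψ, compl_compl]
      congr 1
      simp only [S, abs_of_nonneg (sub_nonneg.2 hAB')]
      push_cast
      ring
    · rw [finrank_eigenspace_heisH hP' hwP hpos hconn hAB'' hψ₀E hψ₀, compl_compl]
      omega
end
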